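/- Let A⁽¹⁾, A⁽²⁾ ∈ ℂ^{n×n} be independent samples from the trace-normalised complex Wishart–Laguerre ensemble with parameters n, m, with eigenvalues λ₁⁽¹⁾ ≥ … ≥ λ_n⁽¹⁾ and λ₁⁽²⁾ ≥ … ≥ λ_n⁽²⁾, and let Π = min_{1 ≤ k ≤ n} (λ_k⁽¹⁾ + λ_{k+1}⁽¹⁾ + … + λ_n⁽¹⁾)/(λ_k⁽²⁾ + λ_{k+1}⁽²⁾ + … + λ_n⁽²⁾). Fix ε > 0 and a constant c ∈ (1,∞). If m = m(n) is a sequence of positive integers with m(n)/n → c as n → ∞, then P[Π < 1 − ε] → 0 as n → ∞. -/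

import Mathlib

open MeasureTheory ProbabilityTheory Filter Topology

noncomputable section

instance {n m α : Type*} [MeasurableSpace α] : MeasurableSpace (Matrix n m α) :=
  inferInstanceAs (MeasurableSpace (n → m → α))

/-- Standard complex Gaussian: `Z = X + iY` with `X, Y` independent real Gaussians of mean 0
and variance 1/2, so that `E[|Z|²] = 1`. -/
def stdCGaussian : Measure ℂ :=
  ((gaussianReal 0 (1/2)).prod (gaussianReal 0 (1/2))).map
    (fun p : ℝ × ℝ => (p.1 : ℂ) + p.2 * Complex.I)

/-- The law of an `n × m` matrix with i.i.d. standard complex Gaussian entries. -/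
def gaussMatrix (n m : ℕ) : Measure (Matrix (Fin n) (Fin m) ℂ) :=
  Measure.pi fun _ : Fin n => Measure.pi fun _ : Fin m => stdCGaussian

/-- The complex Wishart--Laguerre ensemble with parameters `n, m`: the law of `G Gᴴ` where
`G` is an `n × m` matrix with i.i.d. standard complex Gaussian entries. -/
def wishart (n m : ℕ) : Measure (Matrix (Fin n) (Fin n) ℂ) :=
  (gaussMatrix n m).map fun G => G * G.conjTranspose

/-- The trace-normalised complex Wishart--Laguerre ensemble: the law of `M / tr M` where `M`
is sampled from the complex Wishart--Laguerre ensemble. -/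
def wishartNorm (n m : ℕ) : Measure (Matrix (Fin n) (Fin n) ℂ) :=
  (wishart n m).map fun M => (Matrix.trace M)⁻¹ • M

/-- The (real) eigenvalues of a Hermitian matrix (junk value `0` if not Hermitian). -/
def eigs {n : ℕ} (M : Matrix (Fin n) (Fin n) ℂ) : Fin n → ℝ :=
  if h : M.IsHermitian then h.eigenvalues else 0

/-- The decreasing rearrangement of a tuple of reals. -/
def sortDesc {n : ℕ} (v : Fin n → ℝ) : Fin n → ℝ :=
  fun i => v (Tuple.sort v i.rev)

/-- `tailSum v k = v k + v (k+1) + ... + v (n-1)` (so with `v` sorted decreasingly and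
`k` the 0-indexed version of the 1-indexed index in the paper, this is `λ_k + ... + λ_n`). -/
def tailSum {n : ℕ} (v : Fin n → ℝ) (k : Fin n) : ℝ :=
  ∑ i ∈ Finset.univ.filter (fun i => k ≤ i), v i

/-- The eigenvalues of `M`, sorted in decreasing order. -/
def eigsDesc {n : ℕ} (M : Matrix (Fin n) (Fin n) ℂ) : Fin n → ℝ := sortDesc (eigs M)

/-- `Π = min_{1 ≤ k ≤ n} (λ_k⁽¹⁾ + ... + λ_n⁽¹⁾)/(λ_k⁽²⁾ + ... + λ_n⁽²⁾)` for the decreasingly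
sorted eigenvalues of `M₁` and `M₂`. -/
def PiRatio {n : ℕ} (M₁ M₂ : Matrix (Fin n) (Fin n) ℂ) : ℝ :=
  ⨅ k : Fin n, tailSum (eigsDesc M₁) k / tailSum (eigsDesc M₂) k

section Concentration

open scoped ENNReal NNReal

lemma lipschitzWith_of_gauge {E : Type*} [NormedAddCommGroup E] {N : E → ℝ}
    {C : ℝ≥0} (hC : ∀ x, N x ≤ C * ‖x‖) {f : E → ℝ}
    (hf : ∀ x y, |f x - f y| ≤ N (x - y)) : LipschitzWith C f :=
  LipschitzWith.of_dist_le_mul fun x y => by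
    rw [Real.dist_eq, dist_eq_norm]
    exact (hf x y).trans (hC _)

variable {E : Type*} [NormedAddCommGroup E] [NormedSpace ℝ E]

lemma abs_fderiv_le {N : E → ℝ} (hN : ∀ (t : ℝ) x, N (t • x) = |t| * N x) {f : E → ℝ}
    (hf : ∀ x y, |f x - f y| ≤ N (x - y)) (x v : E) (hx : DifferentiableAt ℝ f x) :
    |fderiv ℝ f x v| ≤ N v := by
  have h0 : 0 ≤ N v := by
    have := (abs_nonneg _).trans (hf v 0)
    simpa using this
  have h1 : HasDerivAt (fun t : ℝ => f (x + t • v)) (fderiv ℝ f x v) 0 := by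
    have h2 : HasDerivAt (fun t : ℝ => x + t • v) v 0 := by
      simpa using ((hasDerivAt_id (0 : ℝ)).smul_const v).const_add x
    have h3 : HasFDerivAt f (fderiv ℝ f x) (x + (0 : ℝ) • v) := by simpa using hx.hasFDerivAt
    exact h3.comp_hasDerivAt (0 : ℝ) h2
  have h4 : LipschitzWith (N v).toNNReal (fun t : ℝ => f (x + t • v)) := by
    refine LipschitzWith.of_dist_le_mul fun s t => ?_
    rw [Real.dist_eq, Real.dist_eq, Real.coe_toNNReal _ h0, mul_comm]
    refine (hf _ _).trans (le_of_eq ?_)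
    rw [← hN]
    congr 1
    module
  have h5 := h1.le_of_lipschitz h4
  rwa [Real.norm_eq_abs, Real.coe_toNNReal _ h0] at h5

lemma lipschitzWith_rotation_fst (p : E × E) :
    LipschitzWith (‖p.1‖₊ + ‖p.2‖₊)
      (fun θ : ℝ => (ContinuousLinearMap.rotation θ p).1) := by
  have hc : LipschitzWith 1 Real.cos := Real.lipschitzWith_cos
  have hs : LipschitzWith 1 Real.sin := Real.lipschitzWith_sin
  refine LipschitzWith.of_dist_le_mul fun s t => ?_
  simp only [ContinuousLinearMap.rotation_apply]
  have h1 := hc.dist_le_mul s t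
  have h2 := hs.dist_le_mul s t
  simp only [NNReal.coe_one, one_mul] at h1 h2
  calc dist (Real.cos s • p.1 + Real.sin s • p.2) (Real.cos t • p.1 + Real.sin t • p.2)
      ≤ dist (Real.cos s • p.1) (Real.cos t • p.1) + dist (Real.sin s • p.2) (Real.sin t • p.2) :=
        dist_add_add_le _ _ _ _
    _ = dist (Real.cos s) (Real.cos t) * ‖p.1‖ + dist (Real.sin s) (Real.sin t) * ‖p.2‖ := by
        simp only [dist_eq_norm, ← sub_smul, norm_smul]
    _ ≤ dist s t * ‖p.1‖ + dist s t * ‖p.2‖ := by gcongr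
    _ = _ := by push_cast; ring

/-- The derivative of `f` at the first coordinate of `p` applied to the second one. -/
def fderivPair (f : E → ℝ) (p : E × E) : ℝ := fderiv ℝ f p.1 p.2

lemma sub_eq_integral_fderivPair {f : E → ℝ} {C : ℝ≥0} (hf : LipschitzWith C f) (p : E × E)
    (hp : ∀ᵐ θ : ℝ, DifferentiableAt ℝ f (ContinuousLinearMap.rotation θ p).1) :
    IntervalIntegrable (fun θ => fderivPair f (ContinuousLinearMap.rotation θ p)) volume
      0 (Real.pi / 2) ∧
    ∫ θ in (0 : ℝ)..(Real.pi / 2), fderivPair f (ContinuousLinearMap.rotation θ p) =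
      f p.2 - f p.1 := by
  have hac : AbsolutelyContinuousOnInterval
      (fun θ : ℝ => f (ContinuousLinearMap.rotation θ p).1) 0 (Real.pi / 2) :=
    ((hf.comp (lipschitzWith_rotation_fst p)).lipschitzOnWith).absolutelyContinuousOnInterval
  have hder : ∀ᵐ θ : ℝ, deriv (fun θ : ℝ => f (ContinuousLinearMap.rotation θ p).1) θ =
      fderivPair f (ContinuousLinearMap.rotation θ p) := by
    filter_upwards [hp] with θ hθ
    refine HasDerivAt.deriv ?_
    have h : HasDerivAt (fun θ : ℝ => (ContinuousLinearMap.rotation θ p).1)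
        (ContinuousLinearMap.rotation θ p).2 θ := by
      simp only [ContinuousLinearMap.rotation_apply]
      exact ((Real.hasDerivAt_cos θ).smul_const p.1).add ((Real.hasDerivAt_sin θ).smul_const p.2)
    exact hθ.hasFDerivAt.comp_hasDerivAt θ h
  constructor
  · exact hac.intervalIntegrable_deriv.congr_ae (ae_restrict_of_ae hder)
  · have h1 := hac.integral_deriv_eq_sub
    rw [intervalIntegral.integral_congr_ae (g := fun θ =>
      fderivPair f (ContinuousLinearMap.rotation θ p)) (hder.mono fun θ h _ => h)] at h1
    rw [h1]
    simp [ContinuousLinearMap.rotation_apply]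

variable [MeasurableSpace E]

/-- `μ` is a centered Gaussian measure, absolutely continuous with respect to a Haar measure,
for which the variance of a linear functional is half its squared dual norm with respect to the
gauge `N`. -/
structure GaussianGauge (μ : Measure E) (N : E → ℝ) : Prop where
  isGaussian : IsGaussian μ
  centered : ∫ x, x ∂μ = 0
  absolutelyContinuous : ∃ ν : Measure E, ν.IsAddHaarMeasure ∧ μ ≪ ν
  le_norm : ∃ C : ℝ≥0, ∀ x, N x ≤ C * ‖x‖
  smul : ∀ (t : ℝ) x, N (t • x) = |t| * N x
  nonneg : ∀ x, 0 ≤ N x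
  exists_variance_eq : ∀ L : StrongDual ℝ E, ∃ y, L y = N y ^ 2 ∧ Var[L; μ] = N y ^ 2 / 2

lemma GaussianGauge.variance_le {μ : Measure E} {N : E → ℝ} (hμ : GaussianGauge μ N)
    {L : StrongDual ℝ E} (hL : ∀ x, |L x| ≤ N x) : Var[L; μ] ≤ 1 / 2 := by
  obtain ⟨y, h1, h2⟩ := hμ.exists_variance_eq L
  have h3 := (le_abs_self _).trans (hL y)
  have h4 := hμ.nonneg y
  rw [h2]
  nlinarith

/-- Jensen's inequality for the exponential, without integrability of the exponential. -/
lemma ofReal_exp_integral_le {α : Type*} [MeasurableSpace α] {P : Measure α}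
    [IsProbabilityMeasure P] {h : α → ℝ} (hi : Integrable h P) :
    ENNReal.ofReal (Real.exp (∫ a, h a ∂P)) ≤ ∫⁻ a, ENNReal.ofReal (Real.exp (h a)) ∂P := by
  by_cases htop : ∫⁻ a, ENNReal.ofReal (Real.exp (h a)) ∂P = ⊤
  · simp [htop]
  have hint : Integrable (fun a => Real.exp (h a)) P := by
    refine ⟨Real.continuous_exp.comp_aestronglyMeasurable hi.1, ?_⟩
    rw [hasFiniteIntegral_iff_ofReal (Eventually.of_forall fun a => (Real.exp_pos _).le)]
    exact lt_top_iff_ne_top.2 htop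
  rw [← ofReal_integral_eq_lintegral_ofReal hint
    (Eventually.of_forall fun a => (Real.exp_pos _).le)]
  exact ENNReal.ofReal_le_ofReal (convexOn_exp.map_integral_le Real.continuous_exp.continuousOn
    isClosed_univ (by simp) hi hint)

variable [BorelSpace E] [FiniteDimensional ℝ E]

lemma GaussianGauge.lintegral_exp_dual_le {μ : Measure E} {N : E → ℝ} (hμ : GaussianGauge μ N)
    {L : StrongDual ℝ E} (hL : ∀ x, |L x| ≤ N x) (t : ℝ) :
    ∫⁻ x, ENNReal.ofReal (Real.exp (t * L x)) ∂μ ≤ ENNReal.ofReal (Real.exp (t ^ 2 / 4)) := by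
  have := hμ.isGaussian
  have : CompleteSpace E := FiniteDimensional.complete ℝ E
  have hmean : μ[L] = 0 := by
    rw [IsGaussian.integral_dual L, hμ.centered, map_zero]
  have hmap := IsGaussian.map_eq_gaussianReal (μ := μ) L
  rw [hmean] at hmap
  have hint : Integrable (fun x => Real.exp (t * L x)) μ := by
    have h := integrable_exp_mul_gaussianReal (μ := 0) (v := Var[L; μ].toNNReal) t
    rw [← hmap, integrable_map_measure (by fun_prop) (by fun_prop)] at h
    exact h
  rw [← ofReal_integral_eq_lintegral_ofReal hint
    (Eventually.of_forall fun a => (Real.exp_pos _).le)]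
  have hm := mgf_gaussianReal hmap t
  rw [mgf] at hm
  rw [hm]
  refine ENNReal.ofReal_le_ofReal (Real.exp_le_exp.2 ?_)
  rw [Real.coe_toNNReal _ (variance_nonneg _ _)]
  nlinarith [hμ.variance_le hL, sq_nonneg t]

lemma measurable_fderivPair (f : E → ℝ) : Measurable (fderivPair f) := by
  have : CompleteSpace E := FiniteDimensional.complete ℝ E
  have h : Continuous fun q : (E →L[ℝ] ℝ) × E => q.1 q.2 := by fun_prop
  exact h.measurable.comp (((measurable_fderiv ℝ f).comp measurable_fst).prodMk measurable_snd)

end Concentration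

section Concentration

open scoped ENNReal NNReal

variable {E : Type*} [NormedAddCommGroup E] [NormedSpace ℝ E] [MeasurableSpace E] [BorelSpace E]
  [FiniteDimensional ℝ E]

/-- Symmetrised Gaussian concentration, by interpolating along rotations. -/
theorem GaussianGauge.lintegral_exp_sub_le {μ : Measure E} {N : E → ℝ} (hμ : GaussianGauge μ N)
    {f : E → ℝ} (hf : ∀ x y, |f x - f y| ≤ N (x - y)) (t : ℝ) :
    ∫⁻ p, ENNReal.ofReal (Real.exp (t * (f p.2 - f p.1))) ∂(μ.prod μ) ≤
      ENNReal.ofReal (Real.exp (t ^ 2)) := by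
  have := hμ.isGaussian
  have : CompleteSpace E := FiniteDimensional.complete ℝ E
  obtain ⟨C, hC⟩ := hμ.le_norm
  obtain ⟨ν, hν, hμν⟩ := hμ.absolutelyContinuous
  have hlip := lipschitzWith_of_gauge hC hf
  have hdiff : ∀ᵐ x ∂μ, DifferentiableAt ℝ f x := hμν.ae_le hlip.ae_differentiableAt
  have hpi : 0 < Real.pi := Real.pi_pos
  have hrot : ∀ θ : ℝ, (μ.prod μ).map (ContinuousLinearMap.rotation θ) = μ.prod μ :=
    fun θ => IsGaussian.map_rotation_eq_self (by simpa using hμ.centered) θ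
  have hrotm : Measurable fun q : (E × E) × ℝ => ContinuousLinearMap.rotation q.2 q.1 := by
    simp only [ContinuousLinearMap.rotation_apply]
    fun_prop
  have hdiff' : ∀ᵐ p ∂(μ.prod μ), ∀ᵐ θ : ℝ,
      DifferentiableAt ℝ f (ContinuousLinearMap.rotation θ p).1 := by
    have hs : MeasurableSet {x | DifferentiableAt ℝ f x} :=
      measurableSet_of_differentiableAt ℝ f
    refine (Measure.ae_ae_comm (p := fun p θ =>
      DifferentiableAt ℝ f (ContinuousLinearMap.rotation θ p).1) ?_).2 ?_
    · exact (measurable_fst.comp hrotm) hs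
    · refine Eventually.of_forall fun θ => ?_
      have h1 : ∀ᵐ q ∂(μ.prod μ), DifferentiableAt ℝ f q.1 :=
        Measure.quasiMeasurePreserving_fst.ae hdiff
      rw [← hrot θ] at h1
      exact ae_of_ae_map (f := ⇑(ContinuousLinearMap.rotation θ))
        (p := fun q : E × E => DifferentiableAt ℝ f q.1) (by fun_prop) h1
  set τ : Measure ℝ := ENNReal.ofReal (2 / Real.pi) • volume.restrict (Set.Ioc 0 (Real.pi / 2))
    with hτ
  have hτp : IsProbabilityMeasure τ := by
    refine ⟨?_⟩
    rw [hτ, Measure.smul_apply, Measure.restrict_apply_univ, Real.volume_Ioc, smul_eq_mul,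
      ← ENNReal.ofReal_mul (by positivity)]
    rw [sub_zero, div_mul_div_comm, mul_comm, div_self (by positivity), ENNReal.ofReal_one]
  set c : ℝ := t * (Real.pi / 2)
  have hpt : ∀ᵐ p ∂(μ.prod μ), ENNReal.ofReal (Real.exp (t * (f p.2 - f p.1))) ≤
      ∫⁻ θ, ENNReal.ofReal
        (Real.exp (c * fderivPair f (ContinuousLinearMap.rotation θ p))) ∂τ := by
    filter_upwards [hdiff'] with p hp
    obtain ⟨hi, he⟩ := sub_eq_integral_fderivPair hlip p hp
    rw [intervalIntegrable_iff_integrableOn_Ioc_of_le (by positivity)] at hi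
    have hi' : Integrable (fun θ => c * fderivPair f (ContinuousLinearMap.rotation θ p)) τ :=
      (Integrable.const_mul hi c).smul_measure ENNReal.ofReal_ne_top
    refine le_trans (le_of_eq ?_) (ofReal_exp_integral_le hi')
    congr 2
    rw [← he, intervalIntegral.integral_of_le (by positivity), hτ, integral_smul_measure,
      integral_const_mul, ENNReal.toReal_ofReal (by positivity), smul_eq_mul]
    simp only [c]
    field_simp
  have hmeas : Measurable fun p : E × E => ENNReal.ofReal (Real.exp (c * fderivPair f p)) :=
    ((measurable_fderivPair f).const_mul c).exp.ennreal_ofReal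
  calc ∫⁻ p, ENNReal.ofReal (Real.exp (t * (f p.2 - f p.1))) ∂(μ.prod μ)
      ≤ ∫⁻ p, ∫⁻ θ, ENNReal.ofReal
        (Real.exp (c * fderivPair f (ContinuousLinearMap.rotation θ p))) ∂τ ∂(μ.prod μ) :=
        lintegral_mono_ae hpt
    _ = ∫⁻ θ, ∫⁻ p, ENNReal.ofReal
        (Real.exp (c * fderivPair f (ContinuousLinearMap.rotation θ p))) ∂(μ.prod μ) ∂τ :=
        lintegral_lintegral_swap (hmeas.comp hrotm).aemeasurable
    _ = ∫⁻ _, ∫⁻ p, ENNReal.ofReal (Real.exp (c * fderivPair f p)) ∂(μ.prod μ) ∂τ := by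
        congr 1 with θ
        conv_rhs => rw [← hrot θ]
        rw [lintegral_map hmeas (by fun_prop)]
    _ = ∫⁻ p, ENNReal.ofReal (Real.exp (c * fderivPair f p)) ∂(μ.prod μ) := by simp
    _ = ∫⁻ x, ∫⁻ y, ENNReal.ofReal (Real.exp (c * fderiv ℝ f x y)) ∂μ ∂μ :=
        lintegral_prod _ hmeas.aemeasurable
    _ ≤ ∫⁻ _, ENNReal.ofReal (Real.exp (c ^ 2 / 4)) ∂μ := by
        refine lintegral_mono_ae ?_
        filter_upwards [hdiff] with x hx
        exact hμ.lintegral_exp_dual_le (fun v => abs_fderiv_le hμ.smul hf x v hx) c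
    _ = ENNReal.ofReal (Real.exp (c ^ 2 / 4)) := by simp
    _ ≤ ENNReal.ofReal (Real.exp (t ^ 2)) := by
        refine ENNReal.ofReal_le_ofReal (Real.exp_le_exp.2 ?_)
        have h4 := Real.pi_le_four
        have : Real.pi ^ 2 ≤ 16 := by nlinarith
        simp only [c]
        nlinarith [sq_nonneg t]

lemma GaussianGauge.integrable {μ : Measure E} {N : E → ℝ} (hμ : GaussianGauge μ N)
    {f : E → ℝ} (hf : ∀ x y, |f x - f y| ≤ N (x - y)) : Integrable f μ := by
  have := hμ.isGaussian
  have : CompleteSpace E := FiniteDimensional.complete ℝ E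
  obtain ⟨C, hC⟩ := hμ.le_norm
  have hi : Integrable (fun x : E => |f 0| + C * ‖x‖) μ :=
    (integrable_const _).add ((IsGaussian.integrable_id (μ := μ)).norm.const_mul _)
  refine hi.mono' (lipschitzWith_of_gauge hC hf).continuous.aestronglyMeasurable
    (Eventually.of_forall fun x => ?_)
  have h1 := (hf x 0).trans (hC _)
  rw [sub_zero] at h1
  rw [Real.norm_eq_abs]
  linarith [abs_sub_abs_le_abs_sub (f x) (f 0)]

/-- Gaussian concentration: a function which is `1`-Lipschitz for the gauge is sub-Gaussian. -/
theorem GaussianGauge.hasSubgaussianMGF {μ : Measure E} {N : E → ℝ} (hμ : GaussianGauge μ N)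
    {f : E → ℝ} (hf : ∀ x y, |f x - f y| ≤ N (x - y)) :
    HasSubgaussianMGF (fun x => f x - ∫ y, f y ∂μ) 2 μ := by
  have := hμ.isGaussian
  have : CompleteSpace E := FiniteDimensional.complete ℝ E
  have hint := hμ.integrable hf
  obtain ⟨C, hC⟩ := hμ.le_norm
  have hcont : Continuous f := (lipschitzWith_of_gauge hC hf).continuous
  have key : ∀ t : ℝ, ∫⁻ x, ENNReal.ofReal (Real.exp (t * (f x - ∫ y, f y ∂μ))) ∂μ ≤
      ENNReal.ofReal (Real.exp (t ^ 2)) := fun t => by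
    have h1 : ∀ x, ENNReal.ofReal (Real.exp (t * (f x - ∫ y, f y ∂μ))) ≤
        ∫⁻ y, ENNReal.ofReal (Real.exp (-t * (f y - f x))) ∂μ := fun x => by
      have hi : Integrable (fun y => -t * (f y - f x)) μ :=
        (hint.sub (integrable_const _)).const_mul _
      refine le_trans (le_of_eq ?_) (ofReal_exp_integral_le hi)
      rw [integral_const_mul, integral_sub hint (integrable_const _)]
      congr 2
      simp
      ring
    refine (lintegral_mono h1).trans ?_
    have h2 := hμ.lintegral_exp_sub_le hf (-t)
    rw [lintegral_prod _ (by fun_prop), neg_sq] at h2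
    exact h2
  have hexp : ∀ t : ℝ, Integrable (fun x => Real.exp (t * (f x - ∫ y, f y ∂μ))) μ := fun t => by
    refine ⟨by fun_prop, ?_⟩
    rw [hasFiniteIntegral_iff_ofReal (Eventually.of_forall fun a => (Real.exp_pos _).le)]
    exact (key t).trans_lt ENNReal.ofReal_lt_top
  refine ⟨hexp, fun t => ?_⟩
  have h3 := key t
  rw [← ofReal_integral_eq_lintegral_ofReal (hexp t)
    (Eventually.of_forall fun a => (Real.exp_pos _).le),
    ENNReal.ofReal_le_ofReal_iff (Real.exp_pos _).le] at h3
  refine h3.trans (le_of_eq ?_)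
  congr 1
  simp

end Concentration

section Product

open scoped ENNReal NNReal

lemma absolutelyContinuous_pi_const {α : Type*} [MeasurableSpace α] {μ ν : Measure α}
    [SigmaFinite μ] [SigmaFinite ν] (h : μ ≪ ν) (n : ℕ) :
    Measure.pi (fun _ : Fin n => μ) ≪ Measure.pi fun _ : Fin n => ν := by
  induction n with
  | zero =>
    rw [Measure.pi_of_empty, Measure.pi_of_empty]
  | succ n ih =>
    rw [← (measurePreserving_piFinSuccAbove (fun _ : Fin (n + 1) => μ) 0).symm.map_eq,
      ← (measurePreserving_piFinSuccAbove (fun _ : Fin (n + 1) => ν) 0).symm.map_eq]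
    exact (h.prod ih).map (MeasurableEquiv.measurable _)

variable {E : Type*} [NormedAddCommGroup E] [NormedSpace ℝ E] [MeasurableSpace E] [BorelSpace E]
  [FiniteDimensional ℝ E]

lemma isGaussian_pi (μ : Measure E) [IsGaussian μ] (n : ℕ) :
    IsGaussian (Measure.pi fun _ : Fin n => μ) := by
  have : CompleteSpace E := FiniteDimensional.complete ℝ E
  have : ProperSpace E := FiniteDimensional.proper ℝ E
  have h := iIndepFun.hasGaussianLaw (P := Measure.pi fun _ : Fin n => μ)
    (X := fun i (x : Fin n → E) => x i) (fun i => ⟨by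
      rw [(measurePreserving_eval (fun _ : Fin n => μ) i).map_eq]; infer_instance⟩)
    (iIndepFun_pi (X := fun _ => id) fun i => aemeasurable_id)
  have h' := h.isGaussian_map
  have hid : (fun (x : Fin n → E) i => x i) = id := rfl
  rwa [hid, Measure.map_id] at h'

lemma variance_dual_pi {μ : Measure E} [IsGaussian μ] {n : ℕ} (L : StrongDual ℝ (Fin n → E)) :
    Var[L; Measure.pi fun _ : Fin n => μ] =
      ∑ i, Var[L.comp (ContinuousLinearMap.single ℝ (fun _ => E) i); μ] := by
  have : CompleteSpace E := FiniteDimensional.complete ℝ E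
  rw [← variance_sum_pi fun i => IsGaussian.memLp_dual μ _ 2 (by simp)]
  congr 1
  ext x
  conv_lhs => rw [← Finset.univ_sum_single x, map_sum]
  rw [Finset.sum_apply]
  rfl

theorem GaussianGauge.pi {μ : Measure E} {N : E → ℝ} (hμ : GaussianGauge μ N) (n : ℕ) :
    GaussianGauge (Measure.pi fun _ : Fin n => μ) (fun x => √(∑ i, N (x i) ^ 2)) := by
  have := hμ.isGaussian
  have : CompleteSpace E := FiniteDimensional.complete ℝ E
  have : ProperSpace E := FiniteDimensional.proper ℝ E
  have hG := isGaussian_pi μ n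
  refine ⟨hG, ?_, ?_, ?_, ?_, fun x => Real.sqrt_nonneg _, ?_⟩
  · ext i
    rw [eval_integral fun i => ?_]
    · rw [integral_comp_eval (μ := fun _ : Fin n => μ) (f := fun x : E => x) (by fun_prop),
        hμ.centered]
      rfl
    · exact integrable_comp_eval (f := fun x => x) IsGaussian.integrable_id
  · obtain ⟨ν, hν, hac⟩ := hμ.absolutelyContinuous
    exact ⟨Measure.pi fun _ => ν, inferInstance, absolutelyContinuous_pi_const hac n⟩
  · obtain ⟨C, hC⟩ := hμ.le_norm
    refine ⟨NNReal.sqrt n * C, fun x => ?_⟩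
    rw [Real.sqrt_le_left (by positivity)]
    have h1 : ∀ i, N (x i) ^ 2 ≤ (C * ‖x‖) ^ 2 := fun i => by
      have := hC (x i)
      have := hμ.nonneg (x i)
      have := norm_le_pi_norm x i
      gcongr
      exact (hC _).trans (by gcongr)
    refine (Finset.sum_le_sum fun i _ => h1 i).trans (le_of_eq ?_)
    simp [mul_pow]
    ring
  · intro t x
    simp only [Pi.smul_apply, hμ.smul, mul_pow]
    rw [← Finset.mul_sum, Real.sqrt_mul (by positivity), Real.sqrt_sq (abs_nonneg t)]
  · intro L
    choose y h1 h2 using fun i =>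
      hμ.exists_variance_eq (L.comp (ContinuousLinearMap.single ℝ (fun _ => E) i))
    refine ⟨y, ?_, ?_⟩
    · rw [Real.sq_sqrt (by positivity)]
      conv_lhs => rw [← Finset.univ_sum_single y, map_sum]
      exact Finset.sum_congr rfl fun i _ => h1 i
    · rw [Real.sq_sqrt (by positivity), variance_dual_pi, Finset.sum_div]
      exact Finset.sum_congr rfl fun i _ => h2 i

end Product

section ComplexGaussian

open scoped ENNReal NNReal

lemma stdCGaussian_eq_map : stdCGaussian =
    ((gaussianReal 0 (1/2)).prod (gaussianReal 0 (1/2))).map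
      Complex.equivRealProdCLM.symm := by
  rw [stdCGaussian]
  congr 1
  ext p
  exact (Complex.equivRealProdCLM_symm_apply p).symm

instance : IsGaussian stdCGaussian := by
  rw [stdCGaussian_eq_map]
  exact isGaussian_map (Complex.equivRealProdCLM.symm : ℝ × ℝ →L[ℝ] ℂ)

lemma variance_dual_stdCGaussian (L : StrongDual ℝ ℂ) :
    Var[L; stdCGaussian] = (L 1 ^ 2 + L Complex.I ^ 2) / 2 := by
  have hv : ∀ a : ℝ, Var[fun x => a * x; gaussianReal 0 (1/2)] = a ^ 2 / 2 := fun a => by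
    rw [variance_const_mul, variance_fun_id_gaussianReal]
    push_cast
    ring
  rw [stdCGaussian_eq_map, variance_map (by fun_prop) (by fun_prop)]
  have h : (L ∘ Complex.equivRealProdCLM.symm) =
      fun p : ℝ × ℝ => L 1 * p.1 + L Complex.I * p.2 := by
    ext p
    have : Complex.equivRealProdCLM.symm p = p.1 • (1 : ℂ) + p.2 • Complex.I := by
      rw [Complex.equivRealProdCLM_symm_apply]
      simp
    rw [Function.comp_apply, this, map_add, map_smul, map_smul, smul_eq_mul, smul_eq_mul]
    ring
  rw [h, variance_add_prod (X := fun x => L 1 * x) (Y := fun x => L Complex.I * x), hv, hv]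
  · ring
  · exact (memLp_id_gaussianReal 2).const_mul _
  · exact (memLp_id_gaussianReal 2).const_mul _

theorem gaussianGauge_stdCGaussian : GaussianGauge stdCGaussian (fun z : ℂ => ‖z‖) := by
  refine ⟨inferInstance, ?_, ?_, ⟨1, by simp⟩, by simp, fun x => norm_nonneg x, ?_⟩
  · rw [stdCGaussian_eq_map, integral_map (by fun_prop) (by fun_prop)]
    have h := ContinuousLinearMap.integral_comp_comm
      (μ := (gaussianReal 0 (1/2)).prod (gaussianReal 0 (1/2)))
      (Complex.equivRealProdCLM.symm : ℝ × ℝ →L[ℝ] ℂ) (φ := id) IsGaussian.integrable_id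
    refine Eq.trans h ?_
    have hz : ∫ x : ℝ × ℝ, id x ∂((gaussianReal 0 (1/2)).prod (gaussianReal 0 (1/2))) = 0 := by
      have hi : Integrable (fun x : ℝ × ℝ => x)
          ((gaussianReal 0 (1/2)).prod (gaussianReal 0 (1/2))) :=
        IsGaussian.integrable_id
      refine Prod.ext ?_ ?_
      · simp only [id]
        rw [fst_integral hi, integral_fun_fst (fun x : ℝ => x)]
        simp
      · simp only [id]
        rw [snd_integral hi, integral_fun_snd (fun x : ℝ => x)]
        simp
    rw [hz, map_zero]
  · refine ⟨(volume.prod volume).map Complex.equivRealProdCLM.symm,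
      ContinuousLinearEquiv.isAddHaarMeasure_map _ _, ?_⟩
    rw [stdCGaussian_eq_map]
    have h := gaussianReal_absolutelyContinuous 0 (v := 1/2) (by simp)
    exact (h.prod h).map (by fun_prop)
  · intro L
    refine ⟨⟨L 1, L Complex.I⟩, ?_, ?_⟩
    · have : (⟨L 1, L Complex.I⟩ : ℂ) = L 1 • (1 : ℂ) + L Complex.I • Complex.I := by
        apply Complex.ext <;> simp
      conv_lhs => rw [this, map_add, map_smul, map_smul]
      rw [← Complex.normSq_eq_norm_sq, Complex.normSq_mk, smul_eq_mul, smul_eq_mul]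
    · rw [variance_dual_stdCGaussian, ← Complex.normSq_eq_norm_sq, Complex.normSq_mk]
      ring

instance : IsProbabilityMeasure stdCGaussian := inferInstance

/-- The law of a vector of i.i.d. standard complex Gaussians. -/
abbrev gaussVector (m : ℕ) : Measure (Fin m → ℂ) := Measure.pi fun _ : Fin m => stdCGaussian

lemma gaussianGauge_gaussVector (m : ℕ) :
    GaussianGauge (gaussVector m) (fun u => √(∑ j, ‖u j‖ ^ 2)) :=
  gaussianGauge_stdCGaussian.pi m

lemma gaussianGauge_gaussMatrix (n m : ℕ) :
    GaussianGauge (E := Fin n → Fin m → ℂ) (gaussMatrix n m)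
      (fun x => √(∑ i, ∑ j, ‖x i j‖ ^ 2)) := by
  have h := (gaussianGauge_gaussVector m).pi n
  have e : (fun x : Fin n → Fin m → ℂ => √(∑ i, ∑ j, ‖x i j‖ ^ 2)) =
      fun x => √(∑ i, √(∑ j, ‖x i j‖ ^ 2) ^ 2) := by
    ext x
    congr 1
    exact Finset.sum_congr rfl fun i _ => (Real.sq_sqrt (by positivity)).symm
  rw [e]
  exact h

lemma integral_sq_dual_gaussVector {m : ℕ} (L : StrongDual ℝ (Fin m → ℂ)) :
    ∫ u, L u ^ 2 ∂(gaussVector m) =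
      ∑ j, (L (Pi.single j 1) ^ 2 + L (Pi.single j Complex.I) ^ 2) / 2 := by
  have := (gaussianGauge_gaussVector m).isGaussian
  have h := variance_dual_pi (μ := stdCGaussian) L
  rw [variance_of_integral_eq_zero (by fun_prop) (by
    rw [IsGaussian.integral_dual L, (gaussianGauge_gaussVector m).centered, map_zero])] at h
  rw [h]
  refine Finset.sum_congr rfl fun j _ => ?_
  rw [variance_dual_stdCGaussian]
  rfl

/-- The second moment of a linear image of a standard complex Gaussian vector. -/
lemma integral_norm_mulVec_sq {ι : Type*} [Fintype ι] {m : ℕ} (B : Matrix ι (Fin m) ℂ) :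
    Integrable (fun u => ∑ i, ‖(B.mulVec u) i‖ ^ 2) (gaussVector m) ∧
    ∫ u, ∑ i, ‖(B.mulVec u) i‖ ^ 2 ∂(gaussVector m) = ∑ i, ∑ j, ‖B i j‖ ^ 2 := by
  have := (gaussianGauge_gaussVector m).isGaussian
  let T : ι → (Fin m → ℂ) →L[ℝ] ℂ := fun i => LinearMap.toContinuousLinearMap
    (((LinearMap.proj i).comp B.mulVecLin).restrictScalars ℝ)
  have hT : ∀ i u, B.mulVec u i = T i u := fun i u => rfl
  have hsq : ∀ i u, ‖B.mulVec u i‖ ^ 2 =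
      (Complex.reCLM.comp (T i)) u ^ 2 + (Complex.imCLM.comp (T i)) u ^ 2 := fun i u => by
    rw [hT, ← Complex.normSq_eq_norm_sq, Complex.normSq_apply]
    simp [sq]
  have hint : ∀ L : StrongDual ℝ (Fin m → ℂ), Integrable (fun u => L u ^ 2) (gaussVector m) :=
    fun L => (IsGaussian.memLp_dual (gaussVector m) L 2 (by simp)).integrable_sq
  constructor
  · refine integrable_finsetSum _ fun i _ => ?_
    simp only [hsq]
    exact (hint _).add (hint _)
  · rw [integral_finsetSum _ fun i _ => by simp only [hsq]; exact (hint _).add (hint _)]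
    refine Finset.sum_congr rfl fun i _ => ?_
    simp only [hsq]
    rw [integral_add (hint _) (hint _), integral_sq_dual_gaussVector,
      integral_sq_dual_gaussVector, ← Finset.sum_add_distrib]
    refine Finset.sum_congr rfl fun j _ => ?_
    have h1 : T i (Pi.single j 1) = B i j := by rw [← hT]; simp
    have h2 : T i (Pi.single j Complex.I) = B i j * Complex.I := by rw [← hT]; simp
    simp only [ContinuousLinearMap.comp_apply, h1, h2]
    rw [← Complex.normSq_eq_norm_sq, Complex.normSq_apply]
    simp
    ring

end ComplexGaussian

section RowUpdate

open Matrix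
open scoped ComplexOrder

variable {ι κ : Type*} [Fintype ι] [Fintype κ]

/-- The squared Euclidean norm of a complex vector. -/
def normSqVec (v : ι → ℂ) : ℝ := ∑ i, ‖v i‖ ^ 2

lemma normSqVec_nonneg (v : ι → ℂ) : 0 ≤ normSqVec v := by
  unfold normSqVec
  positivity

lemma norm_sq_le_normSqVec (v : ι → ℂ) (i : ι) : ‖v i‖ ^ 2 ≤ normSqVec v :=
  Finset.single_le_sum (f := fun i => ‖v i‖ ^ 2) (fun i _ => by positivity) (Finset.mem_univ i)

lemma star_dotProduct_self (v : ι → ℂ) : star v ⬝ᵥ v = (normSqVec v : ℂ) := by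
  simp only [dotProduct, normSqVec, Pi.star_apply, Complex.ofReal_sum]
  refine Finset.sum_congr rfl fun i _ => ?_
  rw [Complex.star_def, ← Complex.normSq_eq_conj_mul_self, Complex.normSq_eq_norm_sq]

lemma star_dotProduct_conjTranspose_mulVec (X : Matrix ι κ ℂ) (v : κ → ℂ) (w : ι → ℂ) :
    star v ⬝ᵥ (Xᴴ *ᵥ w) = star (X *ᵥ v) ⬝ᵥ w := by
  rw [star_mulVec, dotProduct_mulVec]

lemma star_dotProduct_gram (X : Matrix ι κ ℂ) (v : ι → ℂ) :
    star v ⬝ᵥ ((X * Xᴴ) *ᵥ v) = (normSqVec (Xᴴ *ᵥ v) : ℂ) := by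
  rw [← star_dotProduct_self, ← mulVec_mulVec, ← star_dotProduct_conjTranspose_mulVec,
    conjTranspose_conjTranspose]

lemma trace_mul_conjTranspose_self (M : Matrix ι κ ℂ) :
    (M * Mᴴ).trace = ((∑ i, ∑ j, ‖M i j‖ ^ 2 : ℝ) : ℂ) := by
  simp only [trace, diag_apply, mul_apply, conjTranspose_apply, Complex.ofReal_sum]
  refine Finset.sum_congr rfl fun i _ => Finset.sum_congr rfl fun j _ => ?_
  rw [Complex.star_def, Complex.mul_conj, Complex.normSq_eq_norm_sq]

lemma trace_re_eq (M : Matrix ι ι ℂ) : M.trace.re = ∑ i, (M i i).re := by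
  simp [trace]

variable [DecidableEq ι]

lemma isUnit_one_add_gram (X : Matrix ι κ ℂ) : IsUnit (1 + X * Xᴴ).det := by
  have h : (1 + X * Xᴴ).PosDef :=
    Matrix.PosDef.one.add_posSemidef (posSemidef_self_mul_conjTranspose X)
  exact (isUnit_iff_isUnit_det _).1 h.isUnit

/-- The resolvent of the Gram matrix of the rows of `X` at `-1`. -/
def gramResolvent (X : Matrix ι κ ℂ) : Matrix ι ι ℂ := (1 + X * Xᴴ)⁻¹

lemma mul_gramResolvent (X : Matrix ι κ ℂ) : (1 + X * Xᴴ) * gramResolvent X = 1 :=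
  mul_nonsing_inv _ (isUnit_one_add_gram X)

lemma gramResolvent_mul (X : Matrix ι κ ℂ) : gramResolvent X * (1 + X * Xᴴ) = 1 :=
  nonsing_inv_mul _ (isUnit_one_add_gram X)

lemma isHermitian_gramResolvent (X : Matrix ι κ ℂ) : (gramResolvent X).IsHermitian :=
  (isHermitian_one.add (isHermitian_mul_conjTranspose_self X)).inv

lemma normSqVec_le_one_add_gram (X : Matrix ι κ ℂ) (v : ι → ℂ) :
    normSqVec v ≤ normSqVec ((1 + X * Xᴴ) *ᵥ v) := by
  have h1 := star_dotProduct_gram X v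
  have h2 : star ((X * Xᴴ) *ᵥ v) ⬝ᵥ v = (normSqVec (Xᴴ *ᵥ v) : ℂ) := by
    rw [← star_dotProduct_conjTranspose_mulVec, conjTranspose_mul, conjTranspose_conjTranspose, h1]
  have h3 : ((normSqVec ((1 + X * Xᴴ) *ᵥ v) : ℝ) : ℂ) =
      ((normSqVec v + 2 * normSqVec (Xᴴ *ᵥ v) + normSqVec ((X * Xᴴ) *ᵥ v) : ℝ) : ℂ) := by
    rw [← star_dotProduct_self, add_mulVec, one_mulVec, star_add, add_dotProduct, dotProduct_add,
      dotProduct_add, h1, h2, star_dotProduct_self, star_dotProduct_self]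
    push_cast
    ring
  rw [Complex.ofReal_inj] at h3
  linarith [normSqVec_nonneg (Xᴴ *ᵥ v), normSqVec_nonneg ((X * Xᴴ) *ᵥ v)]

lemma normSqVec_gramResolvent_mulVec_le (X : Matrix ι κ ℂ) (v : ι → ℂ) :
    normSqVec (gramResolvent X *ᵥ v) ≤ normSqVec v := by
  refine (normSqVec_le_one_add_gram X _).trans (le_of_eq ?_)
  rw [mulVec_mulVec, mul_gramResolvent X, one_mulVec]

lemma normSqVec_single (k : ι) : normSqVec (Pi.single k 1 : ι → ℂ) = 1 := by
  rw [normSqVec, Finset.sum_eq_single k] <;> simp +contextual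

lemma normSqVec_gramResolvent_single_le (X : Matrix ι κ ℂ) (k : ι) :
    normSqVec (gramResolvent X *ᵥ Pi.single k 1) ≤ 1 :=
  (normSqVec_gramResolvent_mulVec_le X _).trans (normSqVec_single k).le

lemma gramResolvent_diag_re_le_one (X : Matrix ι κ ℂ) (k : ι) : (gramResolvent X k k).re ≤ 1 := by
  have h := (norm_sq_le_normSqVec _ k).trans (normSqVec_gramResolvent_single_le X k)
  rw [mulVec_single_one] at h
  have h1 := (abs_le.1 (Complex.abs_re_le_norm (gramResolvent X k k))).2
  refine h1.trans ?_
  exact (sq_le_one_iff₀ (norm_nonneg _)).1 h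

lemma gramResolvent_diag_re_nonneg (X : Matrix ι κ ℂ) (k : ι) : 0 ≤ (gramResolvent X k k).re := by
  have h : (gramResolvent X).PosDef :=
    (Matrix.PosDef.one.add_posSemidef (posSemidef_self_mul_conjTranspose X)).inv
  exact (Complex.le_def.1 (h.posSemidef.diag_nonneg (i := k))).1

/-- The Frobenius norm of `(1 + H Hᴴ)⁻¹ H` is controlled by the trace of `(1 + H Hᴴ)⁻¹`. -/
lemma sum_norm_sq_gramResolvent_mul_le (H : Matrix ι κ ℂ) :
    ∑ i, ∑ j, ‖(gramResolvent H * H) i j‖ ^ 2 ≤ ∑ i, (gramResolvent H i i).re := by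
  set R := gramResolvent H with hR
  have hRh : Rᴴ = R := isHermitian_gramResolvent H
  have h1 : R * H * (R * H)ᴴ = R - R * Rᴴ := by
    have h2 : R * (1 + H * Hᴴ) = 1 := gramResolvent_mul H
    have h3 : R * (H * Hᴴ) = 1 - R := by
      rw [Matrix.mul_add, Matrix.mul_one] at h2
      exact eq_sub_of_add_eq' h2
    rw [conjTranspose_mul, hRh, Matrix.mul_assoc, ← Matrix.mul_assoc H, ← Matrix.mul_assoc R, h3,
      Matrix.sub_mul, Matrix.one_mul]
  have h4 := congrArg Complex.re (trace_mul_conjTranspose_self (R * H))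
  rw [h1, trace_sub, trace_mul_conjTranspose_self, Complex.sub_re, Complex.ofReal_re,
    Complex.ofReal_re, trace_re_eq] at h4
  have h5 : 0 ≤ ∑ i, ∑ j, ‖R i j‖ ^ 2 := by positivity
  linarith

variable [DecidableEq κ]

/-- Schur complement formulas for the `k`-th column of the resolvent after replacing the vanishing
`k`-th row of `H` by `g`. -/
lemma gramResolvent_updateRow (H : Matrix ι κ ℂ) (k : ι) (hk : H k = 0) (g : κ → ℂ) :
    ∃ s : ℝ, 1 + normSqVec (gramResolvent Hᴴ *ᵥ star g) ≤ s ∧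
      (gramResolvent (H.updateRow k g) k k).re = 1 / s ∧
      normSqVec (gramResolvent (H.updateRow k g) *ᵥ Pi.single k 1) =
        (1 + normSqVec (gramResolvent H *ᵥ (H *ᵥ star g))) / s ^ 2 := by
  set G := H.updateRow k g with hG
  set u : κ → ℂ := star g with hu
  set b : ι → ℂ := H *ᵥ u with hb
  set y : ι → ℂ := gramResolvent H *ᵥ b with hy
  set r : κ → ℂ := u - Hᴴ *ᵥ y with hr
  have hAy : y + H *ᵥ (Hᴴ *ᵥ y) = b := by
    have : (1 + H * Hᴴ) *ᵥ y = b := by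
      rw [hy, mulVec_mulVec, mul_gramResolvent H, one_mulVec]
    rwa [add_mulVec, one_mulVec, ← mulVec_mulVec] at this
  have hH0 : ∀ v, (H *ᵥ v) k = 0 := fun v => by
    rw [mulVec, hk, zero_dotProduct]
  have hyk : y k = 0 := by
    have := congrFun hAy k
    rw [Pi.add_apply, hH0, hb, hH0, add_zero] at this
    exact this
  have hCr : (1 + Hᴴ * H) *ᵥ r = u := by
    have h1 : H *ᵥ r = y := by
      rw [hr, mulVec_sub, ← hb, ← hAy, add_sub_cancel_right]
    rw [add_mulVec, one_mulVec, ← mulVec_mulVec, h1, hr, sub_add_cancel]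
  have hr' : gramResolvent Hᴴ *ᵥ u = r := by
    have hun := gramResolvent_mul Hᴴ
    rw [conjTranspose_conjTranspose] at hun
    rw [← hCr, mulVec_mulVec, hun, one_mulVec]
  rw [hr']
  set s : ℝ := 1 + normSqVec r + normSqVec (H *ᵥ r) with hs
  have hs0 : 1 ≤ s := by
    linarith [normSqVec_nonneg r, normSqVec_nonneg (H *ᵥ r)]
  have hur : star u ⬝ᵥ r = ((normSqVec r + normSqVec (H *ᵥ r) : ℝ) : ℂ) := by
    have h := star_dotProduct_gram Hᴴ r
    rw [conjTranspose_conjTranspose] at h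
    nth_rewrite 1 [← hCr]
    rw [star_mulVec, ← dotProduct_mulVec, conjTranspose_add, conjTranspose_one,
      conjTranspose_mul, conjTranspose_conjTranspose, add_mulVec, one_mulVec, dotProduct_add, h,
      star_dotProduct_self]
    push_cast
    rfl
  set w : ι → ℂ := Pi.single k 1 - y with hw
  have hGw : Gᴴ *ᵥ w = r := by
    ext j
    rw [hr, Pi.sub_apply, hw, mulVec_sub, Pi.sub_apply, mulVec_single_one]
    congr 1
    · simp [hG, hu]
    · simp only [mulVec, dotProduct, conjTranspose_apply]
      refine Finset.sum_congr rfl fun i _ => ?_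
      by_cases hi : i = k
      · rw [hi, hyk, mul_zero, mul_zero]
      · rw [hG, updateRow_ne hi]
  have hAw : (1 + G * Gᴴ) *ᵥ w = (s : ℂ) • Pi.single k 1 := by
    rw [add_mulVec, one_mulVec, ← mulVec_mulVec, hGw]
    ext i
    by_cases hi : i = k
    · subst hi
      have h1 : (G *ᵥ r) i = star u ⬝ᵥ r := by
        rw [mulVec, hG, updateRow_self, hu, star_star]
      rw [Pi.add_apply, h1, hur, hw, Pi.sub_apply, hyk, hs]
      simp
      ring
    · have h1 : (G *ᵥ r) i = (H *ᵥ r) i := by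
        rw [mulVec, mulVec, hG, updateRow_ne hi]
      have h2 : H *ᵥ r = y := by
        rw [hr, mulVec_sub, ← hb, ← hAy, add_sub_cancel_right]
      rw [Pi.add_apply, h1, h2, hw]
      simp [hi]
  have hs' : (s : ℂ) ≠ 0 := by
    exact_mod_cast (by linarith : s ≠ 0)
  have hR : gramResolvent G *ᵥ Pi.single k 1 = (s : ℂ)⁻¹ • w := by
    have : (Pi.single k 1 : ι → ℂ) = (s : ℂ)⁻¹ • ((1 + G * Gᴴ) *ᵥ w) := by
      rw [hAw, smul_smul, inv_mul_cancel₀ hs', one_smul]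
    rw [this, mulVec_smul, mulVec_mulVec, gramResolvent_mul G, one_mulVec]
  refine ⟨s, by linarith [normSqVec_nonneg (H *ᵥ r)], ?_, ?_⟩
  · have h1 : gramResolvent G k k = (s : ℂ)⁻¹ := by
      have := congrFun hR k
      rw [mulVec_single_one] at this
      simpa [hw, hyk] using this
    rw [h1, ← Complex.ofReal_inv, Complex.ofReal_re, one_div]
  · rw [hR]
    have h1 : ∀ i, ‖((s : ℂ)⁻¹ • w) i‖ ^ 2 =
        (‖(Pi.single k 1 : ι → ℂ) i‖ ^ 2 + ‖y i‖ ^ 2) / s ^ 2 := fun i => by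
      have h2 : ‖w i‖ ^ 2 = ‖(Pi.single k 1 : ι → ℂ) i‖ ^ 2 + ‖y i‖ ^ 2 := by
        by_cases hi : i = k
        · subst hi; simp [hw, hyk]
        · simp [hw, hi]
      rw [Pi.smul_apply, norm_smul, mul_pow, h2, norm_inv, Complex.norm_real, inv_pow,
        Real.norm_eq_abs, sq_abs]
      ring
    rw [normSqVec, Finset.sum_congr rfl fun i _ => h1 i, ← Finset.sum_div, Finset.sum_add_distrib]
    congr 2
    exact normSqVec_single k

lemma gramResolvent_mul_eq (H : Matrix ι κ ℂ) : gramResolvent H * H = H * gramResolvent Hᴴ := by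
  have hun := mul_gramResolvent Hᴴ
  rw [conjTranspose_conjTranspose] at hun
  have h : H * (1 + Hᴴ * H) = (1 + H * Hᴴ) * H := by
    rw [Matrix.mul_add, Matrix.add_mul, Matrix.mul_one, Matrix.one_mul, Matrix.mul_assoc]
  calc gramResolvent H * H = gramResolvent H * (H * (1 + Hᴴ * H)) * gramResolvent Hᴴ := by
        rw [Matrix.mul_assoc, Matrix.mul_assoc, hun, Matrix.mul_one]
    _ = _ := by
        rw [h, ← Matrix.mul_assoc, gramResolvent_mul H, Matrix.one_mul]

/-- A lower bound on the Frobenius norm of `(1 + Hᴴ H)⁻¹` when `H` has fewer rows than columns. -/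
lemma le_sum_norm_sq_gramResolvent (H : Matrix ι κ ℂ) (h : Fintype.card ι ≤ Fintype.card κ) :
    ((Fintype.card κ : ℝ) - Fintype.card ι) ^ 2 ≤
      Fintype.card κ * ∑ i, ∑ j, ‖gramResolvent Hᴴ i j‖ ^ 2 := by
  set C := gramResolvent Hᴴ with hC
  have hun := mul_gramResolvent Hᴴ
  rw [conjTranspose_conjTranspose] at hun
  have htr : (Fintype.card κ : ℝ) - Fintype.card ι ≤ C.trace.re := by
    have h1 : C = 1 - Hᴴ * (H * C) := by
      have h2 : (1 + Hᴴ * H) * C = 1 := hun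
      rw [Matrix.add_mul, Matrix.one_mul, Matrix.mul_assoc] at h2
      exact eq_sub_of_add_eq h2
    have h3 : gramResolvent H * (H * Hᴴ) = 1 - gramResolvent H := by
      have h2 : gramResolvent H * (1 + H * Hᴴ) = 1 := gramResolvent_mul H
      rw [Matrix.mul_add, Matrix.mul_one] at h2
      exact eq_sub_of_add_eq' h2
    rw [h1, ← gramResolvent_mul_eq, trace_sub, trace_mul_comm, Matrix.mul_assoc, h3, trace_sub,
      trace_one, trace_one, Complex.sub_re, Complex.sub_re, trace_re_eq]
    have := Finset.sum_nonneg fun i (_ : i ∈ Finset.univ) => gramResolvent_diag_re_nonneg H i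
    simp
    linarith
  have h0 : (0 : ℝ) ≤ (Fintype.card κ : ℝ) - Fintype.card ι := by
    rw [sub_nonneg]
    exact_mod_cast h
  calc ((Fintype.card κ : ℝ) - Fintype.card ι) ^ 2 ≤ (∑ i, (C i i).re) ^ 2 := by
        rw [← trace_re_eq]
        gcongr
    _ ≤ Fintype.card κ * ∑ i, (C i i).re ^ 2 := sq_sum_le_card_mul_sum_sq
    _ ≤ _ := by
        gcongr with i
        refine le_trans ?_ (Finset.single_le_sum (f := fun j => ‖C i j‖ ^ 2)
          (fun j _ => by positivity) (Finset.mem_univ i))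
        rw [← sq_abs (C i i).re]
        gcongr
        exact Complex.abs_re_le_norm _

end RowUpdate

section RowEstimates

open Matrix
open scoped ENNReal

variable {ι κ : Type*} [Fintype ι] [Fintype κ]

lemma sqrt_normSqVec (v : ι → ℂ) : √(normSqVec v) = ‖WithLp.toLp 2 v‖ := by
  rw [EuclideanSpace.norm_eq]
  rfl

lemma abs_sqrt_normSqVec_sub_le (v w : ι → ℂ) :
    |√(normSqVec v) - √(normSqVec w)| ≤ √(normSqVec (v - w)) := by
  simp only [sqrt_normSqVec, WithLp.toLp_sub]
  exact abs_norm_sub_norm_le _ _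

lemma normSqVec_mulVec_star (M : Matrix ι κ ℂ) (g : κ → ℂ) :
    normSqVec (M *ᵥ star g) = normSqVec (M.map star *ᵥ g) := by
  refine Finset.sum_congr rfl fun i _ => ?_
  rw [← norm_star]
  congr 2
  simp [mulVec, dotProduct, mul_comm]

lemma continuous_normSqVec_mulVec (M : Matrix ι κ ℂ) :
    Continuous fun g : κ → ℂ => normSqVec (M *ᵥ g) := by
  unfold normSqVec
  simp only [mulVec, dotProduct]
  fun_prop

lemma sq_le_exp_add_exp_neg (x : ℝ) : x ^ 2 ≤ 2 * (Real.exp x + Real.exp (-x)) := by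
  rcases le_total 0 x with h | h
  · linarith [Real.quadratic_le_exp_of_nonneg h, Real.exp_pos (-x)]
  · nlinarith [Real.quadratic_le_exp_of_nonneg (neg_nonneg.2 h), Real.exp_pos x]

lemma HasSubgaussianMGF.integral_sq_le {Ω : Type*} [MeasurableSpace Ω] {P : Measure Ω}
    {X : Ω → ℝ} (hX : HasSubgaussianMGF X 2 P) : ∫ ω, X ω ^ 2 ∂P ≤ 12 := by
  have h1 := hX.integrable_exp_mul 1
  have h2 := hX.integrable_exp_mul (-1)
  have m1 := hX.mgf_le 1
  have m2 := hX.mgf_le (-1)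
  simp only [mgf] at m1 m2
  have he : Real.exp 1 ≤ 3 := by linarith [Real.exp_one_lt_d9]
  norm_num at m1 m2
  calc ∫ ω, X ω ^ 2 ∂P ≤ ∫ ω, 2 * (Real.exp (1 * X ω) + Real.exp (-1 * X ω)) ∂P := by
        refine integral_mono_of_nonneg (Eventually.of_forall fun ω => sq_nonneg _)
          ((h1.add h2).const_mul 2)
          (Eventually.of_forall fun ω => ?_)
        simpa using sq_le_exp_add_exp_neg (X ω)
    _ ≤ 12 := by
        rw [integral_const_mul, integral_add h1 h2]
        simp only [one_mul, neg_one_mul]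
        linarith

/-- A nonnegative gauge-Lipschitz function with large second moment is rarely small. -/
lemma GaussianGauge.measureReal_sq_lt_le {E : Type*} [NormedAddCommGroup E] [NormedSpace ℝ E]
    [MeasurableSpace E] [BorelSpace E] [FiniteDimensional ℝ E] {μ : Measure E} {N : E → ℝ}
    (hμ : GaussianGauge μ N) {f : E → ℝ} (hf : ∀ x y, |f x - f y| ≤ N (x - y))
    (hf0 : ∀ x, 0 ≤ f x) {V : ℝ} (hV : 24 ≤ V) (hfi : Integrable (fun x => f x ^ 2) μ)
    (hfV : V ≤ ∫ x, f x ^ 2 ∂μ) :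
    μ.real {x | f x ^ 2 < V / 8} ≤ Real.exp (-V / 32) := by
  have := hμ.isGaussian
  have hX := hμ.hasSubgaussianMGF hf
  have hint := hμ.integrable hf
  set e := ∫ y, f y ∂μ with he
  have he0 : 0 ≤ e := integral_nonneg hf0
  have hvar : ∫ x, (f x - e) ^ 2 ∂μ = ∫ x, f x ^ 2 ∂μ - e ^ 2 := by
    have h1 : ∀ x, (f x - e) ^ 2 = f x ^ 2 - (2 * e * f x - e ^ 2) := fun x => by ring
    simp only [h1]
    have hi : Integrable (fun x => 2 * e * f x - e ^ 2) μ :=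
      (hint.const_mul _).sub (integrable_const _)
    rw [integral_sub hfi hi,
      integral_sub (hint.const_mul _) (integrable_const _), integral_const_mul, ← he]
    simp
    ring
  have hle := HasSubgaussianMGF.integral_sq_le hX
  rw [hvar] at hle
  have he2 : V / 2 ≤ e ^ 2 := by linarith
  have htail := hX.neg.measure_ge_le (ε := e / 2) (by positivity)
  calc μ.real {x | f x ^ 2 < V / 8} ≤ μ.real {x | e / 2 ≤ (-fun x => f x - e) x} := by
        refine measureReal_mono fun x hx => ?_
        simp only [Set.mem_ofPred_eq, Pi.neg_apply] at hx ⊢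
        have : f x < e / 2 := lt_of_pow_lt_pow_left₀ 2 (by positivity) (by nlinarith)
        linarith
    _ ≤ _ := htail
    _ ≤ _ := by
        refine Real.exp_le_exp.2 ?_
        norm_num
        nlinarith

variable {n m : ℕ}

/-- The probability that a row update of a matrix with fewer rows than columns stays near the span
of the other rows is exponentially small. -/
lemma gaussVector_normSqVec_lt_le (H : Matrix (Fin n) (Fin m) ℂ) (hnm : n ≤ m)
    (hV : 24 ≤ ((m : ℝ) - n) ^ 2 / m) :
    gaussVector m {g | normSqVec (gramResolvent Hᴴ *ᵥ star g) < ((m : ℝ) - n) ^ 2 / m / 8} ≤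
      ENNReal.ofReal (Real.exp (-(((m : ℝ) - n) ^ 2 / m) / 32)) := by
  set V := ((m : ℝ) - n) ^ 2 / m with hVdef
  set M := (gramResolvent Hᴴ).map star with hM
  have hμ := gaussianGauge_gaussVector m
  have hm0 : (0 : ℝ) < m := by
    rcases Nat.eq_zero_or_pos m with h | h
    · simp [V, h] at hV
      norm_num at hV
    · exact_mod_cast h
  have hmom := integral_norm_mulVec_sq M
  have hF := le_sum_norm_sq_gramResolvent H (by simpa using hnm)
  have hF' : V ≤ ∑ i, ∑ j, ‖M i j‖ ^ 2 := by
    simp only [hM, map_apply, norm_star]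
    rw [hVdef, div_le_iff₀ hm0, mul_comm]
    simpa using hF
  have hsq : ∀ g : Fin m → ℂ, √(normSqVec (M *ᵥ g)) ^ 2 = normSqVec (M *ᵥ g) := fun g =>
    Real.sq_sqrt (normSqVec_nonneg _)
  have h := hμ.measureReal_sq_lt_le (f := fun g => √(normSqVec (M *ᵥ g))) (fun x y => by
      refine (abs_sqrt_normSqVec_sub_le _ _).trans (Real.sqrt_le_sqrt ?_)
      rw [← mulVec_sub, hM, ← normSqVec_mulVec_star]
      refine (normSqVec_gramResolvent_mulVec_le _ _).trans (le_of_eq ?_)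
      simp [normSqVec, ← map_sub]) (fun x => Real.sqrt_nonneg _) hV
    (by simp only [hsq]; exact hmom.1) (by simp only [hsq]; exact hF'.trans hmom.2.ge)
  simp only [hsq] at h
  simp only [normSqVec_mulVec_star]
  rw [← ENNReal.ofReal_toReal (measure_ne_top (gaussVector m) _)]
  exact ENNReal.ofReal_le_ofReal h

lemma lintegral_normSqVec_mulVec_star (M : Matrix ι (Fin m) ℂ) :
    ∫⁻ g, ENNReal.ofReal (normSqVec (M *ᵥ star g)) ∂(gaussVector m) =
      ENNReal.ofReal (∑ i, ∑ j, ‖M i j‖ ^ 2) := by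
  have hmom := integral_norm_mulVec_sq (M.map star)
  simp only [normSqVec_mulVec_star]
  refine (ofReal_integral_eq_lintegral_ofReal hmom.1
    (Eventually.of_forall fun g => normSqVec_nonneg _)).symm.trans ?_
  congr 1
  refine hmom.2.trans ?_
  simp

lemma lintegral_add_indicator_le {α : Type*} [MeasurableSpace α] {P : Measure α}
    {s : Set α} (hs : MeasurableSet s) (f : α → ℝ≥0∞) {q : ℝ≥0∞} (hq : P s ≤ q) :
    ∫⁻ a, (f a + s.indicator 1 a) ∂P ≤ ∫⁻ a, f a ∂P + q := by
  rw [lintegral_add_right _ (measurable_one.indicator hs), lintegral_indicator_one hs]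
  gcongr

lemma measurableSet_normSqVec_lt (M : Matrix ι (Fin m) ℂ) (a : ℝ) :
    MeasurableSet {g : Fin m → ℂ | normSqVec (M *ᵥ star g) < a} := by
  refine measurableSet_lt ?_ measurable_const
  exact ((continuous_normSqVec_mulVec M).comp continuous_star).measurable

lemma lintegral_gramResolvent_diag_le (H : Matrix (Fin n) (Fin m) ℂ) (hnm : n ≤ m)
    (hV : 24 ≤ ((m : ℝ) - n) ^ 2 / m) (k : Fin n) (hk : H k = 0) :
    ∫⁻ g, ENNReal.ofReal (gramResolvent (H.updateRow k g) k k).re ∂(gaussVector m) ≤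
      ENNReal.ofReal (8 / (((m : ℝ) - n) ^ 2 / m)) +
        ENNReal.ofReal (Real.exp (-(((m : ℝ) - n) ^ 2 / m) / 32)) := by
  have hbad := gaussVector_normSqVec_lt_le H hnm hV
  set V := ((m : ℝ) - n) ^ 2 / m
  have := (gaussianGauge_gaussVector m).isGaussian
  set s : Set (Fin m → ℂ) := {g | normSqVec (gramResolvent Hᴴ *ᵥ star g) < V / 8} with hs
  have h := lintegral_add_indicator_le (s := s)
    (measurableSet_normSqVec_lt (gramResolvent Hᴴ) (V / 8))
    (fun _ => ENNReal.ofReal (8 / V)) hbad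
  rw [lintegral_const, measure_univ, mul_one] at h
  refine (lintegral_mono fun g => ?_).trans h
  obtain ⟨t, ht, h1, -⟩ := gramResolvent_updateRow H k hk g
  by_cases hg : normSqVec (gramResolvent Hᴴ *ᵥ star g) < V / 8
  · refine le_add_left ?_
    refine le_trans ?_ (Set.indicator_of_mem (show g ∈ s from hg) 1).ge
    rw [Pi.one_apply, ENNReal.ofReal_le_one]
    exact gramResolvent_diag_re_le_one _ _
  · refine le_add_right (ENNReal.ofReal_le_ofReal ?_)
    rw [h1, div_le_div_iff₀ (by linarith [normSqVec_nonneg (gramResolvent Hᴴ *ᵥ star g)])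
      (by linarith)]
    linarith

lemma lintegral_gramResolvent_column_le (H : Matrix (Fin n) (Fin m) ℂ) (hnm : n ≤ m)
    (hV : 24 ≤ ((m : ℝ) - n) ^ 2 / m) (k : Fin n) (hk : H k = 0) :
    ∫⁻ g, ENNReal.ofReal (normSqVec (gramResolvent (H.updateRow k g) *ᵥ Pi.single k 1))
        ∂(gaussVector m) ≤
      ENNReal.ofReal ((8 / (((m : ℝ) - n) ^ 2 / m)) ^ 2) *
          (1 + ∑ i, ENNReal.ofReal (gramResolvent H i i).re) +
        ENNReal.ofReal (Real.exp (-(((m : ℝ) - n) ^ 2 / m) / 32)) := by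
  have hbad := gaussVector_normSqVec_lt_le H hnm hV
  set V := ((m : ℝ) - n) ^ 2 / m
  have := (gaussianGauge_gaussVector m).isGaussian
  set s : Set (Fin m → ℂ) := {g | normSqVec (gramResolvent Hᴴ *ᵥ star g) < V / 8} with hs
  have h := lintegral_add_indicator_le (s := s)
    (measurableSet_normSqVec_lt (gramResolvent Hᴴ) (V / 8))
    (fun g => ENNReal.ofReal ((8 / V) ^ 2) *
      (1 + ENNReal.ofReal (normSqVec ((gramResolvent H * H) *ᵥ star g)))) hbad
  rw [lintegral_const_mul' _ _ ENNReal.ofReal_ne_top, lintegral_add_left measurable_const,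
    lintegral_normSqVec_mulVec_star, lintegral_const, measure_univ, one_mul] at h
  rw [← ENNReal.ofReal_sum_of_nonneg fun i _ => gramResolvent_diag_re_nonneg H i]
  refine ((lintegral_mono fun g => ?_).trans h).trans ?_
  · obtain ⟨t, ht, -, h1⟩ := gramResolvent_updateRow H k hk g
    by_cases hg : normSqVec (gramResolvent Hᴴ *ᵥ star g) < V / 8
    · refine le_add_left ?_
      refine le_trans ?_ (Set.indicator_of_mem (show g ∈ s from hg) 1).ge
      rw [Pi.one_apply, ENNReal.ofReal_le_one]
      exact normSqVec_gramResolvent_single_le _ _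
    · refine le_add_right ?_
      rw [← ENNReal.ofReal_one, ← ENNReal.ofReal_add zero_le_one (normSqVec_nonneg _),
        ← ENNReal.ofReal_mul (by positivity), h1, ← mulVec_mulVec]
      refine ENNReal.ofReal_le_ofReal ?_
      have hy := normSqVec_nonneg (gramResolvent H *ᵥ H *ᵥ star g)
      have h2 : 1 / t ≤ 8 / V := by
        rw [div_le_div_iff₀ (by linarith [normSqVec_nonneg (gramResolvent Hᴴ *ᵥ star g)])
          (by linarith)]
        linarith
      have ht0 : 0 ≤ 1 / t := by
        have := normSqVec_nonneg (gramResolvent Hᴴ *ᵥ star g)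
        exact div_nonneg zero_le_one (by linarith)
      calc _ = (1 / t) ^ 2 * (1 + normSqVec (gramResolvent H *ᵥ H *ᵥ star g)) := by ring
        _ ≤ _ := by gcongr
  · gcongr ENNReal.ofReal _ * (1 + ENNReal.ofReal ?_) + _
    exact sum_norm_sq_gramResolvent_mul_le H

/-- Resampling one row of a Gaussian matrix. -/
lemma lintegral_gaussMatrix_updateRow {F : Matrix (Fin n) (Fin m) ℂ → ℝ≥0∞} (hF : Measurable F)
    (k : Fin n) :
    ∫⁻ G, F G ∂(gaussMatrix n m) =
      ∫⁻ G, ∫⁻ g, F (G.updateRow k g) ∂(gaussVector m) ∂(gaussMatrix n m) := by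
  have := (gaussianGauge_gaussVector m).isGaussian
  have hF' : Measurable (fun G : Fin n → Fin m → ℂ => F G) := hF
  set F₁ : (Fin n → Fin m → ℂ) → ℝ≥0∞ :=
    fun G => ∫⁻ g, F (Function.update G k g) ∂(gaussVector m) with hF₁
  have hup : Measurable fun p : (Fin n → Fin m → ℂ) × (Fin m → ℂ) =>
      Function.update p.1 k p.2 := by
    refine measurable_pi_lambda _ fun i => ?_
    by_cases hi : i = k
    · subst hi; simpa using measurable_snd
    · simp only [Function.update_of_ne hi]; fun_prop
  have hF₁m : Measurable F₁ := (hF'.comp hup).lintegral_prod_right'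
  have h1 := lintegral_eq_lmarginal_univ (μ := fun _ : Fin n => gaussVector m) (f := F)
    (0 : Fin n → Fin m → ℂ)
  have h2 := lintegral_eq_lmarginal_univ (μ := fun _ : Fin n => gaussVector m) (f := F₁)
    (0 : Fin n → Fin m → ℂ)
  refine h1.trans (Eq.trans ?_ h2.symm)
  rw [lmarginal_erase' _ hF' (Finset.mem_univ k), lmarginal_erase' _ hF₁m (Finset.mem_univ k)]
  congr 2
  ext G
  simp [F₁]

end RowEstimates

section ResolventExpectation

open Matrix
open scoped ENNReal

variable {n m : ℕ}

instance : BorelSpace (Matrix (Fin n) (Fin m) ℂ) :=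
  inferInstanceAs (BorelSpace (Fin n → Fin m → ℂ))

lemma continuous_gramResolvent :
    Continuous (gramResolvent : Matrix (Fin n) (Fin m) ℂ → Matrix (Fin n) (Fin n) ℂ) := by
  have h1 : Continuous fun X : Matrix (Fin n) (Fin m) ℂ => 1 + X * Xᴴ := by fun_prop
  have h2 : (gramResolvent : Matrix (Fin n) (Fin m) ℂ → Matrix (Fin n) (Fin n) ℂ) =
      fun X => (1 + X * Xᴴ).det⁻¹ • (1 + X * Xᴴ).adjugate := by
    ext X : 1
    rw [gramResolvent, inv_def, Ring.inverse_eq_inv']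
  rw [h2]
  exact (h1.matrix_det.inv₀ fun X => (isUnit_one_add_gram X).ne_zero).smul h1.matrix_adjugate

lemma measurable_gramResolvent_diag (k : Fin n) :
    Measurable fun X : Matrix (Fin n) (Fin m) ℂ => ENNReal.ofReal (gramResolvent X k k).re := by
  have : Continuous fun X : Matrix (Fin n) (Fin m) ℂ => (gramResolvent X k k).re :=
    Complex.continuous_re.comp (continuous_gramResolvent.matrix_elem k k)
  exact this.measurable.ennreal_ofReal

lemma measurable_gramResolvent_column (k : Fin n) :
    Measurable fun X : Matrix (Fin n) (Fin m) ℂ =>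
      ENNReal.ofReal (normSqVec (gramResolvent X *ᵥ Pi.single k 1)) := by
  have : Continuous fun X : Matrix (Fin n) (Fin m) ℂ =>
      normSqVec (gramResolvent X *ᵥ Pi.single k 1) := by
    simp only [mulVec_single_one, normSqVec]
    exact continuous_finsetSum _ fun i _ =>
      ((continuous_gramResolvent.matrix_elem i k).norm).pow 2
  exact this.measurable.ennreal_ofReal

instance : IsProbabilityMeasure (gaussMatrix n m) :=
  inferInstanceAs (IsProbabilityMeasure
    (Measure.pi fun _ : Fin n => Measure.pi fun _ : Fin m => stdCGaussian))

lemma updateRow_updateRow_comm (G : Matrix (Fin n) (Fin m) ℂ) {i k : Fin n} (h : i ≠ k)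
    (a b : Fin m → ℂ) : (G.updateRow i a).updateRow k b = (G.updateRow k b).updateRow i a :=
  Function.update_comm h _ _ _

lemma updateRow_updateRow (G : Matrix (Fin n) (Fin m) ℂ) (k : Fin n)
    (a b : Fin m → ℂ) : (G.updateRow k a).updateRow k b = G.updateRow k b :=
  Function.update_idem _ _ _

lemma measurable_updateRow_zero (i : Fin n) :
    Measurable fun G : Matrix (Fin n) (Fin m) ℂ => G.updateRow i 0 :=
  measurable_update_left

/-- The expected trace of the resolvent of a Gaussian matrix with one row removed. -/
lemma lintegral_trace_gramResolvent_le (hnm : n ≤ m) (hV : 24 ≤ ((m : ℝ) - n) ^ 2 / m)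
    (i : Fin n) :
    ∫⁻ G, ∑ k, ENNReal.ofReal (gramResolvent (G.updateRow i 0) k k).re ∂(gaussMatrix n m) ≤
      1 + n * (ENNReal.ofReal (8 / (((m : ℝ) - n) ^ 2 / m)) +
        ENNReal.ofReal (Real.exp (-(((m : ℝ) - n) ^ 2 / m) / 32))) := by
  set a := ENNReal.ofReal (8 / (((m : ℝ) - n) ^ 2 / m)) +
        ENNReal.ofReal (Real.exp (-(((m : ℝ) - n) ^ 2 / m) / 32)) with ha
  have hmeas : ∀ k : Fin n, Measurable fun G : Matrix (Fin n) (Fin m) ℂ =>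
      ENNReal.ofReal (gramResolvent (G.updateRow i 0) k k).re := fun k =>
    (measurable_gramResolvent_diag (m := m) k).comp (measurable_updateRow_zero i)
  have h1 : ∀ k ∈ Finset.univ.erase i,
      ∫⁻ G, ENNReal.ofReal (gramResolvent (G.updateRow i 0) k k).re ∂(gaussMatrix n m) ≤ a := by
    intro k hk
    have hki : i ≠ k := (Finset.ne_of_mem_erase hk).symm
    rw [lintegral_gaussMatrix_updateRow (hmeas k) k]
    refine (lintegral_mono (g := fun _ => a) fun G => ?_).trans (by simp)
    have h := lintegral_gramResolvent_diag_le ((G.updateRow i 0).updateRow k 0) hnm hV k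
      (updateRow_self ..)
    have he : ∀ g, ((G.updateRow i 0).updateRow k 0).updateRow k g =
        (G.updateRow k g).updateRow i 0 := fun g => by
      rw [updateRow_updateRow, updateRow_updateRow_comm G hki]
    simp only [he] at h
    exact h
  rw [lintegral_finsetSum _ fun k _ => hmeas k, ← Finset.add_sum_erase _ _ (Finset.mem_univ i)]
  refine add_le_add ?_ ((Finset.sum_le_sum h1).trans ?_)
  · refine (lintegral_mono (g := fun _ => 1) fun G => ?_).trans (by simp)
    rw [ENNReal.ofReal_le_one]
    exact gramResolvent_diag_re_le_one _ _
  · rw [Finset.sum_const, nsmul_eq_mul]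
    gcongr
    simp

/-- The expected squared Frobenius norm of the resolvent of a Gaussian matrix. -/
lemma lintegral_frobenius_gramResolvent_le (hnm : n ≤ m) (hV : 24 ≤ ((m : ℝ) - n) ^ 2 / m) :
    ∫⁻ G, ∑ k, ENNReal.ofReal (normSqVec (gramResolvent G *ᵥ Pi.single k 1)) ∂(gaussMatrix n m) ≤
      n * (ENNReal.ofReal ((8 / (((m : ℝ) - n) ^ 2 / m)) ^ 2) *
          (1 + (1 + n * (ENNReal.ofReal (8 / (((m : ℝ) - n) ^ 2 / m)) +
            ENNReal.ofReal (Real.exp (-(((m : ℝ) - n) ^ 2 / m) / 32))))) +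
        ENNReal.ofReal (Real.exp (-(((m : ℝ) - n) ^ 2 / m) / 32))) := by
  rw [lintegral_finsetSum _ fun k _ => measurable_gramResolvent_column k]
  refine (Finset.sum_le_card_nsmul _ _ _ fun k _ => ?_).trans
    (by rw [Finset.card_univ, Fintype.card_fin, nsmul_eq_mul])
  rw [lintegral_gaussMatrix_updateRow (measurable_gramResolvent_column k) k]
  refine (lintegral_mono (g := fun G => ENNReal.ofReal ((8 / (((m : ℝ) - n) ^ 2 / m)) ^ 2) *
      (1 + ∑ i, ENNReal.ofReal (gramResolvent (G.updateRow k 0) i i).re) +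
      ENNReal.ofReal (Real.exp (-(((m : ℝ) - n) ^ 2 / m) / 32))) fun G => ?_).trans
    ((lintegral_add_right _ measurable_const).trans_le ?_)
  · have h := lintegral_gramResolvent_column_le (G.updateRow k 0) hnm hV k (updateRow_self ..)
    simp only [updateRow_updateRow] at h
    exact h
  · rw [lintegral_const_mul' _ _ ENNReal.ofReal_ne_top, lintegral_add_left measurable_const,
      lintegral_const, lintegral_const, measure_univ, mul_one, mul_one]
    gcongr
    exact lintegral_trace_gramResolvent_le hnm hV k

end ResolventExpectation

section KyFan

open Matrix

variable {n : ℕ}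

/-- The smallest `n - k` entries of `v` are those in `s`, separated from the others by `t`. -/
lemma exists_tailSum_sortDesc_eq (v : Fin n → ℝ) (k : Fin n) :
    ∃ (s : Finset (Fin n)) (t : ℝ), s.card = n - k ∧ tailSum (sortDesc v) k = ∑ j ∈ s, v j ∧
      (∀ j ∈ s, v j ≤ t) ∧ ∀ j ∉ s, t ≤ v j := by
  have hm : Monotone (v ∘ Tuple.sort v) := Tuple.monotone_sort v
  let e : Fin n ≃ Fin n := Fin.revPerm.trans (Tuple.sort v)
  have he : ∀ i, sortDesc v i = v (e i) := fun i => rfl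
  have hanti : ∀ i j, i ≤ j → v (e j) ≤ v (e i) := fun i j hij => hm (Fin.rev_le_rev.mpr hij)
  refine ⟨(Finset.univ.filter (fun i => k ≤ i)).map e.toEmbedding, v (e k), ?_, ?_, ?_, ?_⟩
  · have : (Finset.univ.filter (fun i => k ≤ i)) = Finset.Ici k := by ext; simp
    rw [Finset.card_map, this, Fin.card_Ici]
  · rw [Finset.sum_map, tailSum]
    rfl
  · intro j hj
    obtain ⟨i, hi, rfl⟩ := Finset.mem_map.mp hj
    exact hanti k i (Finset.mem_filter.mp hi).2
  · intro j hj
    have : ¬ k ≤ e.symm j := fun h => hj <| Finset.mem_map.mpr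
      ⟨e.symm j, Finset.mem_filter.mpr ⟨Finset.mem_univ _, h⟩, e.apply_symm_apply j⟩
    have h := hanti (e.symm j) k (le_of_not_ge this)
    rwa [e.apply_symm_apply] at h

/-- An orthogonal projection of rank `r`. -/
structure IsRankProj (r : ℕ) (P : Matrix (Fin n) (Fin n) ℂ) : Prop where
  isHermitian : P.IsHermitian
  mul_self : P * P = P
  trace : P.trace = r

lemma IsRankProj.conj {r : ℕ} {P : Matrix (Fin n) (Fin n) ℂ} (hP : IsRankProj r P)
    {U : Matrix (Fin n) (Fin n) ℂ} (hU : U * Uᴴ = 1) : IsRankProj r (Uᴴ * P * U) where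
  isHermitian := isHermitian_conjTranspose_mul_mul U hP.isHermitian
  mul_self := by
    calc Uᴴ * P * U * (Uᴴ * P * U) = Uᴴ * P * (U * Uᴴ) * P * U := by noncomm_ring
      _ = Uᴴ * (P * P) * U := by rw [hU]; noncomm_ring
      _ = _ := by rw [hP.mul_self]
  trace := by rw [trace_mul_comm, ← mul_assoc, hU, one_mul, hP.trace]

lemma IsRankProj.diag_re_mem {r : ℕ} {P : Matrix (Fin n) (Fin n) ℂ} (hP : IsRankProj r P)
    (i : Fin n) : 0 ≤ (P i i).re ∧ (P i i).re ≤ 1 := by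
  have h1 : P i i = ((∑ j, ‖P i j‖ ^ 2 : ℝ) : ℂ) := by
    conv_lhs => rw [← hP.mul_self, mul_apply]
    push_cast
    refine Finset.sum_congr rfl fun j _ => ?_
    rw [← hP.isHermitian.apply j i, Complex.star_def, Complex.mul_conj']
  have h2 : (P i i).re = ∑ j, ‖P i j‖ ^ 2 := by rw [h1, Complex.ofReal_re]
  have h0 : 0 ≤ (P i i).re := by rw [h2]; positivity
  refine ⟨h0, ?_⟩
  have h3 : ‖P i i‖ ^ 2 ≤ (P i i).re := by
    rw [h2]
    exact Finset.single_le_sum (f := fun j => ‖P i j‖ ^ 2) (fun _ _ => by positivity)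
      (Finset.mem_univ i)
  have h4 : ‖P i i‖ = (P i i).re := by
    rw [h1, Complex.norm_real, Complex.ofReal_re, Real.norm_of_nonneg (by positivity)]
  rw [h4] at h3
  nlinarith

lemma sum_le_sum_mul_of_threshold {ι : Type*} [Fintype ι] [DecidableEq ι] {v p : ι → ℝ}
    {s : Finset ι} {t : ℝ} (h0 : ∀ i, 0 ≤ p i) (h1 : ∀ i, p i ≤ 1) (hp : ∑ i, p i = s.card)
    (hs : ∀ j ∈ s, v j ≤ t) (hs' : ∀ j ∉ s, t ≤ v j) : ∑ j ∈ s, v j ≤ ∑ j, v j * p j := by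
  have h2 : ∑ j, (v j - t) * (p j - if j ∈ s then 1 else 0) ≥ 0 := by
    refine Finset.sum_nonneg fun j _ => ?_
    split_ifs with hj
    · nlinarith [hs j hj, h1 j]
    · nlinarith [hs' j hj, h0 j]
  have h3 : ∑ j, (v j - t) * (p j - if j ∈ s then 1 else 0) =
      ∑ j, v j * p j - ∑ j ∈ s, v j - t * (∑ j, p j - s.card) := by
    simp only [mul_sub, sub_mul, Finset.sum_sub_distrib, mul_ite, mul_one, mul_zero,
      Finset.sum_ite_mem, Finset.univ_inter, ← Finset.mul_sum, Finset.sum_const, nsmul_eq_mul]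
    ring
  rw [hp, sub_self, mul_zero, sub_zero] at h3
  linarith

lemma exists_eigenvalues_decomposition {M : Matrix (Fin n) (Fin n) ℂ} (hM : M.IsHermitian) :
    ∃ U : Matrix (Fin n) (Fin n) ℂ, U * Uᴴ = 1 ∧ Uᴴ * U = 1 ∧
      M = U * diagonal (fun i => (hM.eigenvalues i : ℂ)) * Uᴴ := by
  refine ⟨hM.eigenvectorUnitary, ?_, ?_, ?_⟩
  · exact Unitary.coe_mul_star_self hM.eigenvectorUnitary
  · exact Unitary.coe_star_mul_self hM.eigenvectorUnitary
  · have h := hM.spectral_theorem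
    rw [Unitary.conjStarAlgAut_apply] at h
    exact h

lemma eigsDesc_eq {M : Matrix (Fin n) (Fin n) ℂ} (hM : M.IsHermitian) :
    eigsDesc M = sortDesc hM.eigenvalues := by
  rw [eigsDesc, eigs, dif_pos hM]

lemma trace_mul_eigenvalues_re {U P : Matrix (Fin n) (Fin n) ℂ} (d : Fin n → ℝ) :
    (P * (U * diagonal (fun i => (d i : ℂ)) * Uᴴ)).trace.re =
      ∑ j, d j * ((Uᴴ * P * U) j j).re := by
  rw [← mul_assoc, trace_mul_comm, ← mul_assoc, ← mul_assoc, trace_re_eq]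
  refine Finset.sum_congr rfl fun j _ => ?_
  rw [mul_diagonal, Complex.mul_re, Complex.ofReal_re, Complex.ofReal_im, mul_zero, sub_zero,
    mul_comm]

/-- Ky Fan's minimum principle, lower bound. -/
theorem tailSum_eigsDesc_le {M : Matrix (Fin n) (Fin n) ℂ} (hM : M.IsHermitian) (k : Fin n)
    {P : Matrix (Fin n) (Fin n) ℂ} (hP : IsRankProj (n - k) P) :
    tailSum (eigsDesc M) k ≤ (P * M).trace.re := by
  obtain ⟨U, hU, -, hMU⟩ := exists_eigenvalues_decomposition hM
  obtain ⟨s, t, hcard, hsum, hs, hs'⟩ := exists_tailSum_sortDesc_eq hM.eigenvalues k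
  have hQ := hP.conj hU
  rw [eigsDesc_eq hM, hsum]
  conv_rhs => rw [hMU]
  rw [trace_mul_eigenvalues_re]
  refine sum_le_sum_mul_of_threshold (fun i => (hQ.diag_re_mem i).1)
    (fun i => (hQ.diag_re_mem i).2) ?_ hs hs'
  rw [← trace_re_eq, hQ.trace, hcard, Complex.natCast_re]

/-- Ky Fan's minimum principle, attainment. -/
theorem exists_tailSum_eigsDesc_eq {M : Matrix (Fin n) (Fin n) ℂ} (hM : M.IsHermitian)
    (k : Fin n) : ∃ P : Matrix (Fin n) (Fin n) ℂ, IsRankProj (n - k) P ∧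
      (P * M).trace.re = tailSum (eigsDesc M) k := by
  obtain ⟨U, hU, hU', hMU⟩ := exists_eigenvalues_decomposition hM
  obtain ⟨s, t, hcard, hsum, -, -⟩ := exists_tailSum_sortDesc_eq hM.eigenvalues k
  set D : Matrix (Fin n) (Fin n) ℂ := diagonal fun i => if i ∈ s then 1 else 0 with hD
  have hDp : IsRankProj (n - k) D := by
    refine ⟨?_, ?_, ?_⟩
    · rw [hD, IsHermitian, diagonal_conjTranspose]
      congr 1
      ext i
      by_cases h : i ∈ s <;> simp [h]
    · rw [hD, diagonal_mul_diagonal]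
      congr 1
      ext i
      by_cases h : i ∈ s <;> simp [h]
    · rw [hD, trace_diagonal, Finset.sum_ite_mem, Finset.univ_inter, Finset.sum_const, hcard,
        nsmul_eq_mul, mul_one]
  have hP := hDp.conj (U := Uᴴ) (by rw [conjTranspose_conjTranspose, hU'])
  rw [conjTranspose_conjTranspose] at hP
  refine ⟨_, hP, ?_⟩
  conv_lhs => rw [hMU]
  rw [trace_mul_eigenvalues_re, eigsDesc_eq hM, hsum]
  have : Uᴴ * (U * D * Uᴴ) * U = D := by
    calc Uᴴ * (U * D * Uᴴ) * U = (Uᴴ * U) * D * (Uᴴ * U) := by noncomm_ring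
      _ = D := by rw [hU', one_mul, mul_one]
  rw [this, hD]
  simp only [diagonal_apply_eq]
  rw [← Finset.univ_inter s, ← Finset.sum_ite_mem, Finset.univ_inter]
  refine Finset.sum_congr rfl fun j _ => ?_
  by_cases h : j ∈ s <;> simp [h]

lemma tailSum_eigsDesc_smul {M : Matrix (Fin n) (Fin n) ℂ} (hM : M.IsHermitian) {a : ℝ}
    (ha : 0 ≤ a) (k : Fin n) :
    tailSum (eigsDesc ((a : ℂ) • M)) k = a * tailSum (eigsDesc M) k := by
  have hM' : ((a : ℂ) • M).IsHermitian := by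
    rw [IsHermitian, conjTranspose_smul, hM, Complex.star_def, Complex.conj_ofReal]
  have h : ∀ P : Matrix (Fin n) (Fin n) ℂ,
      (P * ((a : ℂ) • M)).trace.re = a * (P * M).trace.re := fun P => by
    rw [Matrix.mul_smul, trace_smul, smul_eq_mul, Complex.re_ofReal_mul]
  obtain ⟨P, hP, hPM⟩ := exists_tailSum_eigsDesc_eq hM k
  obtain ⟨Q, hQ, hQM⟩ := exists_tailSum_eigsDesc_eq hM' k
  refine le_antisymm ?_ ?_
  · rw [← hPM, ← h]
    exact tailSum_eigsDesc_le hM' k hP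
  · rw [← hQM, h]
    exact mul_le_mul_of_nonneg_left (tailSum_eigsDesc_le hM k hQ) ha

lemma le_tailSum_eigsDesc {M : Matrix (Fin n) (Fin n) ℂ} (hM : M.IsHermitian) {L : ℝ}
    (hL : ∀ i, L ≤ hM.eigenvalues i) (k : Fin n) :
    ((n - k : ℕ) : ℝ) * L ≤ tailSum (eigsDesc M) k := by
  obtain ⟨s, t, hcard, hsum, -, -⟩ := exists_tailSum_sortDesc_eq hM.eigenvalues k
  rw [eigsDesc_eq hM, hsum, ← hcard, ← nsmul_eq_mul]
  exact Finset.card_nsmul_le_sum _ _ _ fun i _ => hL i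

lemma tailSum_eigsDesc_zero {M : Matrix (Fin n) (Fin n) ℂ} (hM : M.IsHermitian) {k : Fin n}
    (hk : (k : ℕ) = 0) : tailSum (eigsDesc M) k = M.trace.re := by
  obtain ⟨s, t, hcard, hsum, -, -⟩ := exists_tailSum_sortDesc_eq hM.eigenvalues k
  have hs : s = Finset.univ := by
    rw [← Finset.card_eq_iff_eq_univ, hcard, hk, Fintype.card_fin, Nat.sub_zero]
  rw [eigsDesc_eq hM, hsum, hs, hM.trace_eq_sum_eigenvalues, Complex.re_sum]
  rfl

/-- The sum of the `n - k` smallest eigenvalues of the Hermitian part is measurable. -/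
lemma measurable_tailSum_hermitianPart (k : Fin n) :
    Measurable fun M : Matrix (Fin n) (Fin n) ℂ =>
      tailSum (eigsDesc (((1 / 2 : ℝ) : ℂ) • (M + Mᴴ))) k := by
  have hH : ∀ M : Matrix (Fin n) (Fin n) ℂ, (((1 / 2 : ℝ) : ℂ) • (M + Mᴴ)).IsHermitian :=
    fun M => by
      rw [IsHermitian, conjTranspose_smul, conjTranspose_add, conjTranspose_conjTranspose,
        Complex.star_def, Complex.conj_ofReal, add_comm]
  refine measurable_of_Iio fun a => IsOpen.measurableSet ?_
  have : (fun M : Matrix (Fin n) (Fin n) ℂ =>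
      tailSum (eigsDesc (((1 / 2 : ℝ) : ℂ) • (M + Mᴴ))) k) ⁻¹' Set.Iio a =
      ⋃ P : {P : Matrix (Fin n) (Fin n) ℂ // IsRankProj (n - k) P},
        {M | (P.1 * (((1 / 2 : ℝ) : ℂ) • (M + Mᴴ))).trace.re < a} := by
    ext M
    rw [Set.mem_iUnion, Set.mem_preimage, Set.mem_Iio]
    constructor
    · intro h
      obtain ⟨P, hP, hPM⟩ := exists_tailSum_eigsDesc_eq (hH M) k
      exact ⟨⟨P, hP⟩, hPM.trans_lt h⟩
    · rintro ⟨P, hP⟩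
      exact (tailSum_eigsDesc_le (hH M) k P.2).trans_lt hP
  rw [this]
  refine isOpen_iUnion fun P => isOpen_lt (Complex.continuous_re.comp ?_) continuous_const
  fun_prop

end KyFan

section TailRoot

open Matrix
open scoped ComplexOrder

variable {n m : ℕ}

/-- The squared Frobenius norm. -/
def frobSq (X : Matrix (Fin n) (Fin m) ℂ) : ℝ := ∑ i, ∑ j, ‖X i j‖ ^ 2

lemma frobSq_nonneg (X : Matrix (Fin n) (Fin m) ℂ) : 0 ≤ frobSq X := by
  unfold frobSq
  positivity

lemma trace_gram_re (X : Matrix (Fin n) (Fin m) ℂ) : (X * Xᴴ).trace.re = frobSq X := by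
  rw [trace_mul_conjTranspose_self, Complex.ofReal_re, frobSq]

lemma trace_proj_mul_gram_re {P : Matrix (Fin n) (Fin n) ℂ} (hP : P.IsHermitian)
    (hP2 : P * P = P) (G : Matrix (Fin n) (Fin m) ℂ) :
    (P * (G * Gᴴ)).trace.re = frobSq (P * G) := by
  have h : (P * G * (P * G)ᴴ).trace = (P * (G * Gᴴ)).trace := by
    calc (P * G * (P * G)ᴴ).trace = (P * (G * Gᴴ) * P).trace := by
          rw [conjTranspose_mul, hP]
          simp only [Matrix.mul_assoc]
      _ = (P * P * (G * Gᴴ)).trace := by rw [trace_mul_comm, ← Matrix.mul_assoc]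
      _ = _ := by rw [hP2]
  rw [← trace_gram_re, h]

lemma frobSq_proj_mul_le {P : Matrix (Fin n) (Fin n) ℂ} (hP : P.IsHermitian)
    (hP2 : P * P = P) (G : Matrix (Fin n) (Fin m) ℂ) : frobSq (P * G) ≤ frobSq G := by
  have hQ : (1 - P).IsHermitian := isHermitian_one.sub hP
  have hQ2 : (1 - P) * (1 - P) = 1 - P := by
    rw [sub_mul, mul_sub, mul_sub, hP2, one_mul, one_mul, mul_one, sub_self, sub_zero]
  have h := trace_proj_mul_gram_re hQ hQ2 G
  rw [sub_mul, one_mul, trace_sub, Complex.sub_re, trace_proj_mul_gram_re hP hP2,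
    trace_gram_re] at h
  linarith [frobSq_nonneg ((1 - P) * G)]

lemma sqrt_frobSq (X : Matrix (Fin n) (Fin m) ℂ) :
    √(frobSq X) = ‖WithLp.toLp 2 fun p : Fin n × Fin m => X p.1 p.2‖ := by
  rw [← sqrt_normSqVec, normSqVec, Fintype.sum_prod_type, frobSq]

lemma sqrt_frobSq_add_le (A B : Matrix (Fin n) (Fin m) ℂ) :
    √(frobSq (A + B)) ≤ √(frobSq A) + √(frobSq B) := by
  rw [sqrt_frobSq, sqrt_frobSq, sqrt_frobSq]
  exact norm_add_le (WithLp.toLp 2 fun p : Fin n × Fin m => A p.1 p.2)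
    (WithLp.toLp 2 fun p : Fin n × Fin m => B p.1 p.2)

lemma frobSq_neg (A : Matrix (Fin n) (Fin m) ℂ) : frobSq (-A) = frobSq A :=
  Finset.sum_congr rfl fun _ _ => Finset.sum_congr rfl fun _ _ => by
    rw [neg_apply, norm_neg]

/-- The square root of the sum of the `n - k` smallest eigenvalues of `G Gᴴ`. -/
def tailRoot (k : Fin n) (G : Matrix (Fin n) (Fin m) ℂ) : ℝ :=
  √(tailSum (eigsDesc (G * Gᴴ)) k)

lemma tailRoot_nonneg (k : Fin n) (G : Matrix (Fin n) (Fin m) ℂ) : 0 ≤ tailRoot k G :=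
  Real.sqrt_nonneg _

lemma eigenvalues_gram_nonneg (G : Matrix (Fin n) (Fin m) ℂ) (i : Fin n) :
    0 ≤ (isHermitian_mul_conjTranspose_self G).eigenvalues i :=
  (posSemidef_self_mul_conjTranspose G).eigenvalues_nonneg i

lemma sq_tailRoot (k : Fin n) (G : Matrix (Fin n) (Fin m) ℂ) :
    tailRoot k G ^ 2 = tailSum (eigsDesc (G * Gᴴ)) k := by
  have := le_tailSum_eigsDesc (isHermitian_mul_conjTranspose_self G) (eigenvalues_gram_nonneg G) k
  exact Real.sq_sqrt (by simpa using this)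

lemma tailRoot_le_add (k : Fin n) (G H : Matrix (Fin n) (Fin m) ℂ) :
    tailRoot k G ≤ tailRoot k H + √(frobSq (G - H)) := by
  obtain ⟨P, hP, hPH⟩ := exists_tailSum_eigsDesc_eq (isHermitian_mul_conjTranspose_self H) k
  have hG := tailSum_eigsDesc_le (isHermitian_mul_conjTranspose_self G) k hP
  rw [trace_proj_mul_gram_re hP.isHermitian hP.mul_self] at hPH hG
  calc tailRoot k G ≤ √(frobSq (P * G)) := Real.sqrt_le_sqrt hG
    _ = √(frobSq (P * H + P * (G - H))) := by rw [← Matrix.mul_add, add_sub_cancel]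
    _ ≤ √(frobSq (P * H)) + √(frobSq (P * (G - H))) := sqrt_frobSq_add_le _ _
    _ ≤ _ := by
        rw [tailRoot, ← hPH]
        refine add_le_add_right (Real.sqrt_le_sqrt ?_) _
        exact frobSq_proj_mul_le hP.isHermitian hP.mul_self _

lemma abs_tailRoot_sub_le (k : Fin n) (G H : Matrix (Fin n) (Fin m) ℂ) :
    |tailRoot k G - tailRoot k H| ≤ √(frobSq (G - H)) := by
  have h1 := tailRoot_le_add k G H
  have h2 := tailRoot_le_add k H G
  rw [← frobSq_neg, neg_sub] at h2
  rw [abs_le]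
  constructor <;> linarith

lemma normSqVec_mulVec_le (A : Matrix (Fin n) (Fin m) ℂ) (v : Fin m → ℂ) :
    normSqVec (A *ᵥ v) ≤ (∑ k, normSqVec (A *ᵥ Pi.single k 1)) * normSqVec v := by
  simp only [mulVec_single_one, normSqVec]
  rw [Finset.sum_comm, Finset.sum_mul]
  refine Finset.sum_le_sum fun i _ => ?_
  calc ‖(A *ᵥ v) i‖ ^ 2 ≤ (∑ j, ‖A i j‖ * ‖v j‖) ^ 2 := by
        gcongr
        exact (norm_sum_le _ _).trans_eq (Finset.sum_congr rfl fun j _ => norm_mul (A i j) (v j))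
    _ ≤ _ := Finset.sum_mul_sq_le_sq_mul_sq _ _ _

/-- The squared Frobenius norm of the resolvent controls the least eigenvalue. -/
lemma one_le_mul_eigenvalue_sq (G : Matrix (Fin n) (Fin m) ℂ) (i : Fin n) :
    1 ≤ (1 + (isHermitian_mul_conjTranspose_self G).eigenvalues i) ^ 2 *
      ∑ k, normSqVec (gramResolvent G *ᵥ Pi.single k 1) := by
  set hM := isHermitian_mul_conjTranspose_self G
  set l := hM.eigenvalues i with hl
  set v : Fin n → ℂ := ⇑(hM.eigenvectorBasis i) with hv
  have h1 : (G * Gᴴ) *ᵥ v = l • v := hM.mulVec_eigenvectorBasis i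
  have hnorm : normSqVec v = 1 := by
    have h := hM.eigenvectorBasis.orthonormal.1 i
    have h' : √(normSqVec v) = 1 := by
      rw [sqrt_normSqVec]
      exact h
    rwa [Real.sqrt_eq_one] at h'
  have h2 : v = ((1 + l : ℝ) : ℂ) • (gramResolvent G *ᵥ v) := by
    calc v = (gramResolvent G * (1 + G * Gᴴ)) *ᵥ v := by rw [gramResolvent_mul, one_mulVec]
      _ = gramResolvent G *ᵥ (v + l • v) := by
          rw [← mulVec_mulVec, add_mulVec, one_mulVec, h1]
      _ = gramResolvent G *ᵥ (((1 + l : ℝ) : ℂ) • v) := by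
          congr 1
          ext j
          simp [add_mul]
      _ = _ := mulVec_smul _ _ _
  have h3 : normSqVec v = (1 + l) ^ 2 * normSqVec (gramResolvent G *ᵥ v) := by
    conv_lhs => rw [h2]
    simp only [normSqVec, Pi.smul_apply, smul_eq_mul, norm_mul, mul_pow, Complex.norm_real,
      Real.norm_eq_abs, sq_abs, Finset.mul_sum]
  have h4 := normSqVec_mulVec_le (gramResolvent G) v
  rw [hnorm, mul_one] at h4
  calc (1 : ℝ) = (1 + l) ^ 2 * normSqVec (gramResolvent G *ᵥ v) := by rw [← h3, hnorm]
    _ ≤ _ := by gcongr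

lemma le_tailRoot {L : ℝ} (hL : 0 ≤ L) (G : Matrix (Fin n) (Fin m) ℂ)
    (hG : ∑ k, normSqVec (gramResolvent G *ᵥ Pi.single k 1) < ((1 + L) ^ 2)⁻¹) (k : Fin n) :
    √((n - k : ℕ) * L) ≤ tailRoot k G := by
  refine Real.sqrt_le_sqrt (le_tailSum_eigsDesc (isHermitian_mul_conjTranspose_self G) ?_ k)
  intro i
  have h := one_le_mul_eigenvalue_sq G i
  have h0 := eigenvalues_gram_nonneg G i
  set l := (isHermitian_mul_conjTranspose_self G).eigenvalues i
  by_contra! hlt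
  have h1 : (1 + l) ^ 2 * ∑ k, normSqVec (gramResolvent G *ᵥ Pi.single k 1) <
      (1 + l) ^ 2 * ((1 + L) ^ 2)⁻¹ := by gcongr
  have h2 : (1 + l) ^ 2 * ((1 + L) ^ 2)⁻¹ ≤ (1 + L) ^ 2 * ((1 + L) ^ 2)⁻¹ := by gcongr
  rw [mul_inv_cancel₀ (by positivity)] at h2
  linarith

end TailRoot

section SmallestEigenvalues

open Matrix
open scoped ENNReal

variable {n m : ℕ}

lemma gaussianGauge_pi_stdCGaussian :
    GaussianGauge (Measure.pi fun _ : Fin n => Measure.pi fun _ : Fin m => stdCGaussian)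
      (fun x => √(∑ i, ∑ j, ‖x i j‖ ^ 2)) :=
  gaussianGauge_gaussMatrix n m

lemma tailRoot_integrable (k : Fin n) :
    Integrable (tailRoot k) (gaussMatrix n m) :=
  gaussianGauge_pi_stdCGaussian.integrable (f := tailRoot k) (abs_tailRoot_sub_le k)

lemma tailRoot_hasSubgaussianMGF (k : Fin n) :
    HasSubgaussianMGF (fun G => tailRoot k G - ∫ H, tailRoot k H ∂(gaussMatrix n m)) 2
      (gaussMatrix n m) :=
  gaussianGauge_pi_stdCGaussian.hasSubgaussianMGF (f := tailRoot k) (abs_tailRoot_sub_le k)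

lemma measureReal_tailRoot_deviation_le (k : Fin n) {e : ℝ} (he : 0 ≤ e) :
    (gaussMatrix n m).real {G | e ≤ |tailRoot k G - ∫ H, tailRoot k H ∂(gaussMatrix n m)|} ≤
      2 * Real.exp (-e ^ 2 / 4) := by
  have h := tailRoot_hasSubgaussianMGF (m := m) k
  have h1 := h.measure_ge_le he
  have h2 := h.neg.measure_ge_le he
  have h4 : (2 * ((2 : NNReal) : ℝ)) = 4 := by norm_num
  rw [h4] at h1 h2
  rw [two_mul]
  refine (measureReal_mono (fun G hG => ?_) (measure_ne_top _ _)).trans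
    ((measureReal_union_le _ _).trans (add_le_add h1 h2))
  rw [Set.mem_ofPred_eq] at hG
  exact le_abs.mp hG

lemma half_le_integral_tailRoot {L : ℝ} (hL : 0 ≤ L)
    (h : (gaussMatrix n m).real {G | ((1 + L) ^ 2)⁻¹ ≤
      ∑ k, normSqVec (gramResolvent G *ᵥ Pi.single k 1)} ≤ 1 / 2) (k : Fin n) :
    √((n - k : ℕ) * L) / 2 ≤ ∫ G, tailRoot k G ∂(gaussMatrix n m) := by
  set S := {G : Matrix (Fin n) (Fin m) ℂ | ((1 + L) ^ 2)⁻¹ ≤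
      ∑ k, normSqVec (gramResolvent G *ᵥ Pi.single k 1)} with hS
  set T := {G : Matrix (Fin n) (Fin m) ℂ | √((n - k : ℕ) * L) ≤ tailRoot k G} with hT
  have h1 : 1 / 2 ≤ (gaussMatrix n m).real T := by
    have h2 : (gaussMatrix n m).real (Set.univ : Set (Matrix (Fin n) (Fin m) ℂ)) ≤
        (gaussMatrix n m).real S + (gaussMatrix n m).real T := by
      refine (measureReal_mono (fun G _ => ?_) (measure_ne_top _ _)).trans
        (measureReal_union_le _ _)
      by_cases hG : G ∈ S
      · exact Or.inl hG
      · exact Or.inr (le_tailRoot hL G (not_le.mp hG) k)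
    rw [probReal_univ] at h2
    linarith
  have h3 := mul_meas_ge_le_integral_of_nonneg
    (Eventually.of_forall fun G => tailRoot_nonneg k G) (tailRoot_integrable (m := m) k)
    √((n - k : ℕ) * L)
  calc √((n - k : ℕ) * L) / 2 = √((n - k : ℕ) * L) * (1 / 2) := by ring
    _ ≤ √((n - k : ℕ) * L) * (gaussMatrix n m).real T := by gcongr
    _ ≤ _ := h3

lemma sum_pow_sub_le {r : ℝ} (h0 : 0 ≤ r) (h1 : r < 1) :
    ∑ k : Fin n, r ^ (n - k : ℕ) ≤ r / (1 - r) := by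
  rw [Fin.sum_univ_eq_sum_range (fun k => r ^ (n - k)), ← Finset.sum_range_reflect]
  have : ∀ j ∈ Finset.range n, r ^ (n - (n - 1 - j)) = r * r ^ j := fun j hj => by
    rw [← pow_succ']
    congr 1
    have := Finset.mem_range.mp hj
    omega
  rw [Finset.sum_congr rfl this, ← Finset.mul_sum, div_eq_mul_inv,
    ← tsum_geometric_of_lt_one h0 h1]
  gcongr
  exact (summable_geometric_of_lt_one h0 h1).sum_le_tsum _ fun _ _ => by positivity

/-- All the sums of smallest eigenvalues concentrate simultaneously. -/
lemma measureReal_exists_tailRoot_deviation_le {L δ : ℝ} (hL : 0 < L) (hδ : 0 < δ)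
    (h : (gaussMatrix n m).real {G | ((1 + L) ^ 2)⁻¹ ≤
      ∑ k, normSqVec (gramResolvent G *ᵥ Pi.single k 1)} ≤ 1 / 2) :
    (gaussMatrix n m).real {G | ∃ k : Fin n, δ * ∫ H, tailRoot k H ∂(gaussMatrix n m) ≤
      |tailRoot k G - ∫ H, tailRoot k H ∂(gaussMatrix n m)|} ≤
      2 * (Real.exp (-(δ ^ 2 * L / 16)) / (1 - Real.exp (-(δ ^ 2 * L / 16)))) := by
  have hlt : Real.exp (-(δ ^ 2 * L / 16)) < 1 := by
    rw [Real.exp_lt_one_iff]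
    have : 0 < δ ^ 2 * L / 16 := by positivity
    linarith
  have hset : {G : Matrix (Fin n) (Fin m) ℂ | ∃ k : Fin n,
      δ * ∫ H, tailRoot k H ∂(gaussMatrix n m) ≤
      |tailRoot k G - ∫ H, tailRoot k H ∂(gaussMatrix n m)|} =
      ⋃ k : Fin n, {G | δ * ∫ H, tailRoot k H ∂(gaussMatrix n m) ≤
      |tailRoot k G - ∫ H, tailRoot k H ∂(gaussMatrix n m)|} := by
    ext G
    rw [Set.mem_iUnion]
    rfl
  rw [hset]
  refine (measureReal_iUnion_fintype_le _).trans ?_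
  refine le_trans (Finset.sum_le_sum fun k _ => ?_)
    ((Finset.mul_sum _ _ _).symm.trans_le
      (mul_le_mul_of_nonneg_left (sum_pow_sub_le (n := n) (Real.exp_nonneg _) hlt) zero_le_two))
  have he := half_le_integral_tailRoot hL.le h k
  set e := ∫ H, tailRoot k H ∂(gaussMatrix n m) with hedef
  have he0 : 0 ≤ e := le_trans (by positivity) he
  refine (measureReal_tailRoot_deviation_le k (by positivity)).trans ?_
  rw [← Real.exp_nat_mul]
  gcongr 2 * Real.exp ?_
  have hsq : (n - k : ℕ) * L ≤ 4 * e ^ 2 := by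
    have h1 : (√((n - k : ℕ) * L) / 2) ^ 2 ≤ e ^ 2 := by gcongr
    rw [div_pow, Real.sq_sqrt (by positivity)] at h1
    linarith
  have h2 : δ ^ 2 * ((n - k : ℕ) * L) ≤ δ ^ 2 * (4 * e ^ 2) := by gcongr
  nlinarith

lemma resolvent_bound_le {N V u : ℝ} (hN : 0 < N) (hV : 24 ≤ V) (hu : N ≤ u * V) :
    N * ((8 / V) ^ 2 * (1 + (1 + N * (8 / V + Real.exp (-V / 32)))) + Real.exp (-V / 32)) ≤
      u ^ 2 * (64 * (2 + 94 * u) + 2048) / N := by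
  have hV0 : 0 < V := by linarith
  have hu0 : 0 < u := by
    by_contra! h
    nlinarith
  have hq : Real.exp (-V / 32) ≤ 2048 / V ^ 2 := by
    have h1 := Real.quadratic_le_exp_of_nonneg (x := V / 32) (by positivity)
    have h2 : V ^ 2 / 2048 ≤ Real.exp (V / 32) := by nlinarith
    rw [neg_div, Real.exp_neg, ← inv_div (V ^ 2)]
    exact inv_anti₀ (by positivity) h2
  have hq' : 2048 / V ^ 2 ≤ 86 / V := by
    rw [div_le_div_iff₀ (by positivity) hV0]
    nlinarith
  have hNV : N / V ≤ u := by rwa [div_le_iff₀ hV0]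
  have h3 : N * (8 / V + Real.exp (-V / 32)) ≤ 94 * u := by
    calc N * (8 / V + Real.exp (-V / 32)) ≤ N * (8 / V + 86 / V) := by gcongr; exact hq.trans hq'
      _ = 94 * (N / V) := by ring
      _ ≤ _ := by gcongr
  calc _ ≤ N * ((8 / V) ^ 2 * (1 + (1 + 94 * u)) + 2048 / V ^ 2) := by gcongr
    _ = (N / V) ^ 2 * (64 * (2 + 94 * u) + 2048) / N := by field_simp; ring
    _ ≤ _ := by gcongr

lemma measureReal_gramResolvent_le {u t : ℝ} (ht : 0 < t) (hn : 0 < n) (hnm : n ≤ m)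
    (hV : 24 ≤ ((m : ℝ) - n) ^ 2 / m) (hu : n ≤ u * (((m : ℝ) - n) ^ 2 / m)) :
    (gaussMatrix n m).real {G | t ≤ ∑ k, normSqVec (gramResolvent G *ᵥ Pi.single k 1)} ≤
      u ^ 2 * (64 * (2 + 94 * u) + 2048) / n / t := by
  have hn' : (0 : ℝ) < n := by exact_mod_cast hn
  have hb := resolvent_bound_le hn' hV hu
  have h1 := lintegral_frobenius_gramResolvent_le hnm hV
  set V := ((m : ℝ) - n) ^ 2 / m with hVdef
  have hV0 : 0 < V := by linarith
  have h2 := mul_meas_ge_le_lintegral (μ := gaussMatrix n m)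
    (f := fun G => ∑ k, ENNReal.ofReal (normSqVec (gramResolvent G *ᵥ Pi.single k 1)))
    (Finset.measurable_sum _ fun k _ => measurable_gramResolvent_column k) (ENNReal.ofReal t)
  have h3 : (n : ℝ≥0∞) * (ENNReal.ofReal ((8 / V) ^ 2) *
      (1 + (1 + n * (ENNReal.ofReal (8 / V) + ENNReal.ofReal (Real.exp (-V / 32))))) +
      ENNReal.ofReal (Real.exp (-V / 32))) =
      ENNReal.ofReal (n * ((8 / V) ^ 2 * (1 + (1 + n * (8 / V + Real.exp (-V / 32)))) +
        Real.exp (-V / 32))) := by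
    have e1 : (1 : ℝ≥0∞) = ENNReal.ofReal 1 := ENNReal.ofReal_one.symm
    rw [e1, ← ENNReal.ofReal_natCast, ← ENNReal.ofReal_add (by positivity) (by positivity),
      ← ENNReal.ofReal_mul (by positivity), ← ENNReal.ofReal_add (by positivity) (by positivity),
      ← ENNReal.ofReal_add (by positivity) (by positivity),
      ← ENNReal.ofReal_mul (by positivity), ← ENNReal.ofReal_add (by positivity) (by positivity),
      ← ENNReal.ofReal_mul (by positivity)]
  rw [h3] at h1
  have h4 := h2.trans (h1.trans (ENNReal.ofReal_le_ofReal hb))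
  have hset : {G : Matrix (Fin n) (Fin m) ℂ | ENNReal.ofReal t ≤
      ∑ k, ENNReal.ofReal (normSqVec (gramResolvent G *ᵥ Pi.single k 1))} =
      {G | t ≤ ∑ k, normSqVec (gramResolvent G *ᵥ Pi.single k 1)} := by
    ext G
    rw [Set.mem_ofPred_eq, Set.mem_ofPred_eq,
      ← ENNReal.ofReal_sum_of_nonneg fun k _ => normSqVec_nonneg _,
      ENNReal.ofReal_le_ofReal_iff (Finset.sum_nonneg fun k _ => normSqVec_nonneg _)]
  rw [hset] at h4
  rw [le_div_iff₀ ht, mul_comm]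
  have h5 := ENNReal.toReal_mono ENNReal.ofReal_ne_top h4
  rwa [ENNReal.toReal_mul, ENNReal.toReal_ofReal ht.le, ENNReal.toReal_ofReal] at h5
  have hu0 : 0 < u := by
    by_contra! h
    nlinarith
  positivity

end SmallestEigenvalues

section Conversion

open Matrix
open scoped ENNReal

variable {n m : ℕ}

lemma one_sub_le_sq_ratio {δ a b x y u v : ℝ} (hδ : 0 < δ) (hδ4 : 4 * δ ≤ 1)
    (hx : |x - a| < δ * a) (hu : |u - a| < δ * a) (hy : |y - b| < δ * b) (hv : |v - b| < δ * b) :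
    1 - 8 * δ ≤ ((y ^ 2)⁻¹ * x ^ 2) / ((v ^ 2)⁻¹ * u ^ 2) := by
  have ha : 0 < a := pos_of_mul_pos_right ((abs_nonneg _).trans_lt hx) hδ.le
  have hb : 0 < b := pos_of_mul_pos_right ((abs_nonneg _).trans_lt hy) hδ.le
  rw [abs_lt] at hx hu hy hv
  have hx1 : (1 - δ) * a ≤ x := by linarith
  have hv1 : (1 - δ) * b ≤ v := by linarith
  have hu1 : u ≤ (1 + δ) * a := by linarith
  have hy1 : y ≤ (1 + δ) * b := by linarith
  have hδ1 : 0 < 1 - δ := by linarith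
  have hu0 : 0 < u := lt_of_lt_of_le (by positivity : 0 < (1 - δ) * a) (by linarith)
  have hy0 : 0 < y := lt_of_lt_of_le (by positivity : 0 < (1 - δ) * b) (by linarith)
  have hx0 : 0 < x := lt_of_lt_of_le (by positivity : 0 < (1 - δ) * a) hx1
  have hv0 : 0 < v := lt_of_lt_of_le (by positivity : 0 < (1 - δ) * b) hv1
  have h1 : 1 - 4 * δ ≤ x * v / (u * y) := by
    rw [le_div_iff₀ (by positivity)]
    calc (1 - 4 * δ) * (u * y) ≤ (1 - 4 * δ) * (((1 + δ) * a) * ((1 + δ) * b)) := by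
          gcongr
      _ = ((1 - 4 * δ) * (1 + δ) ^ 2) * (a * b) := by ring
      _ ≤ (1 - δ) ^ 2 * (a * b) := by
          gcongr
          nlinarith [pow_pos hδ 3, pow_pos hδ 2]
      _ = ((1 - δ) * a) * ((1 - δ) * b) := by ring
      _ ≤ _ := by gcongr
  have h2 : ((y ^ 2)⁻¹ * x ^ 2) / ((v ^ 2)⁻¹ * u ^ 2) = (x * v / (u * y)) ^ 2 := by
    field_simp
  rw [h2]
  calc 1 - 8 * δ ≤ (1 - 4 * δ) ^ 2 := by nlinarith
    _ ≤ _ := by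
      gcongr

/-- The trace-normalised Gram matrix. -/
def normGram (G : Matrix (Fin n) (Fin m) ℂ) : Matrix (Fin n) (Fin n) ℂ :=
  (G * Gᴴ).trace⁻¹ • (G * Gᴴ)

lemma normGram_eq (G : Matrix (Fin n) (Fin m) ℂ) :
    normGram G = (((frobSq G)⁻¹ : ℝ) : ℂ) • (G * Gᴴ) := by
  rw [normGram, trace_mul_conjTranspose_self, ← Complex.ofReal_inv, frobSq]

lemma isHermitian_normGram (G : Matrix (Fin n) (Fin m) ℂ) : (normGram G).IsHermitian := by
  rw [normGram_eq, IsHermitian, conjTranspose_smul, isHermitian_mul_conjTranspose_self,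
    Complex.star_def, Complex.conj_ofReal]

lemma tailSum_eigsDesc_normGram (G : Matrix (Fin n) (Fin m) ℂ) (k : Fin n) {k₀ : Fin n}
    (hk₀ : (k₀ : ℕ) = 0) :
    tailSum (eigsDesc (normGram G)) k = (tailRoot k₀ G ^ 2)⁻¹ * tailRoot k G ^ 2 := by
  rw [normGram_eq, tailSum_eigsDesc_smul (isHermitian_mul_conjTranspose_self G)
    (inv_nonneg.mpr (frobSq_nonneg G)), sq_tailRoot, sq_tailRoot,
    tailSum_eigsDesc_zero (isHermitian_mul_conjTranspose_self G) hk₀, trace_gram_re]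

lemma measurable_gram : Measurable fun G : Matrix (Fin n) (Fin m) ℂ => G * Gᴴ :=
  (by fun_prop : Continuous fun G : Matrix (Fin n) (Fin m) ℂ => G * Gᴴ).measurable

lemma measurable_inv_trace_smul :
    Measurable fun M : Matrix (Fin n) (Fin n) ℂ => M.trace⁻¹ • M := by
  have htr : Measurable fun M : Matrix (Fin n) (Fin n) ℂ => M.trace⁻¹ :=
    (by fun_prop : Continuous fun M : Matrix (Fin n) (Fin n) ℂ => M.trace).measurable.inv
  have hentry : ∀ i j, Measurable fun M : Matrix (Fin n) (Fin n) ℂ => M i j := fun i j =>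
    (by fun_prop : Continuous fun M : Matrix (Fin n) (Fin n) ℂ => M i j).measurable
  exact measurable_pi_lambda _ fun i => measurable_pi_lambda _ fun j => htr.mul (hentry i j)

lemma measurable_normGram :
    Measurable (normGram : Matrix (Fin n) (Fin m) ℂ → Matrix (Fin n) (Fin n) ℂ) :=
  measurable_inv_trace_smul.comp measurable_gram

lemma wishartNorm_eq_map : wishartNorm n m = (gaussMatrix n m).map normGram :=
  Measure.map_map measurable_inv_trace_smul measurable_gram

/-- A measurable set containing the Hermitian pairs with conversion probability below `a`. -/
def badPairs (n : ℕ) (a : ℝ) :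
    Set (Matrix (Fin n) (Fin n) ℂ × Matrix (Fin n) (Fin n) ℂ) :=
  {p | p.1.IsHermitian → p.2.IsHermitian → ∃ k : Fin n,
    tailSum (eigsDesc (((1 / 2 : ℝ) : ℂ) • (p.1 + p.1ᴴ))) k /
      tailSum (eigsDesc (((1 / 2 : ℝ) : ℂ) • (p.2 + p.2ᴴ))) k < a}

lemma measurableSet_isHermitian :
    MeasurableSet {M : Matrix (Fin n) (Fin n) ℂ | M.IsHermitian} :=
  (isClosed_eq (by fun_prop) continuous_id : IsClosed {M : Matrix (Fin n) (Fin n) ℂ | Mᴴ = M})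
    |>.measurableSet

lemma measurableSet_badPairs (a : ℝ) : MeasurableSet (badPairs n a) := by
  have h1 : MeasurableSet {p : Matrix (Fin n) (Fin n) ℂ × Matrix (Fin n) (Fin n) ℂ |
      p.1.IsHermitian} := measurable_fst measurableSet_isHermitian
  have h2 : MeasurableSet {p : Matrix (Fin n) (Fin n) ℂ × Matrix (Fin n) (Fin n) ℂ |
      p.2.IsHermitian} := measurable_snd measurableSet_isHermitian
  refine h1.imp (h2.imp ?_)
  rw [Set.ofPred_exists]
  refine MeasurableSet.iUnion fun k => measurableSet_lt ?_ measurable_const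
  exact ((measurable_tailSum_hermitianPart k).comp measurable_fst).div
    ((measurable_tailSum_hermitianPart k).comp measurable_snd)

lemma half_smul_add_conjTranspose {M : Matrix (Fin n) (Fin n) ℂ} (hM : M.IsHermitian) :
    ((1 / 2 : ℝ) : ℂ) • (M + Mᴴ) = M := by
  rw [hM, ← two_smul ℂ M, smul_smul]
  norm_num

lemma setOf_piRatio_lt_subset (hn : 0 < n) (a : ℝ) :
    {p : Matrix (Fin n) (Fin n) ℂ × Matrix (Fin n) (Fin n) ℂ | PiRatio p.1 p.2 < a} ⊆
      badPairs n a := by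
  intro p hp h1 h2
  have : Nonempty (Fin n) := ⟨⟨0, hn⟩⟩
  obtain ⟨k, hk⟩ := exists_lt_of_ciInf_lt
    (show ⨅ k, tailSum (eigsDesc p.1) k / tailSum (eigsDesc p.2) k < a from hp)
  refine ⟨k, ?_⟩
  rwa [half_smul_add_conjTranspose h1, half_smul_add_conjTranspose h2]

/-- Finite-size bound on the probability that the conversion probability is small. -/
theorem wishartNorm_prod_piRatio_lt_le {ε δ L : ℝ} (hn : 0 < n) (hδ : 0 < δ) (hδ4 : 4 * δ ≤ 1)
    (hδε : 8 * δ ≤ ε) (hL : 0 < L)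
    (h : (gaussMatrix n m).real {G | ((1 + L) ^ 2)⁻¹ ≤
      ∑ k, normSqVec (gramResolvent G *ᵥ Pi.single k 1)} ≤ 1 / 2) :
    ((wishartNorm n m).prod (wishartNorm n m)) {p | PiRatio p.1 p.2 < 1 - ε} ≤
      ENNReal.ofReal
        (4 * (Real.exp (-(δ ^ 2 * L / 16)) / (1 - Real.exp (-(δ ^ 2 * L / 16))))) := by
  set e : Fin n → ℝ := fun k => ∫ H, tailRoot k H ∂(gaussMatrix n m) with he
  set bad : Set (Matrix (Fin n) (Fin m) ℂ) :=
    {G | ∃ k : Fin n, δ * e k ≤ |tailRoot k G - e k|} with hbad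
  have hb := measureReal_exists_tailRoot_deviation_le hL hδ h
  set B := Real.exp (-(δ ^ 2 * L / 16)) / (1 - Real.exp (-(δ ^ 2 * L / 16))) with hB
  have hbad_le : gaussMatrix n m bad ≤ ENNReal.ofReal (2 * B) := by
    rw [← ofReal_measureReal]
    exact ENNReal.ofReal_le_ofReal hb
  have hB0 : 0 ≤ 2 * B := measureReal_nonneg.trans hb
  refine (measure_mono (setOf_piRatio_lt_subset hn _)).trans ?_
  rw [wishartNorm_eq_map, Measure.map_prod_map _ _ measurable_normGram measurable_normGram,
    Measure.map_apply (measurable_normGram.prodMap measurable_normGram) (measurableSet_badPairs _)]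
  have hsub : Prod.map normGram normGram ⁻¹' badPairs n (1 - ε) ⊆
      bad ×ˢ Set.univ ∪ Set.univ ×ˢ bad := by
    rintro ⟨G₁, G₂⟩ hG
    by_contra hgood
    rw [Set.mem_union, not_or, Set.mem_prod, Set.mem_prod] at hgood
    have hg1 : ∀ k, |tailRoot k G₁ - e k| < δ * e k := fun k =>
      not_le.mp fun hk => hgood.1 ⟨⟨k, hk⟩, Set.mem_univ _⟩
    have hg2 : ∀ k, |tailRoot k G₂ - e k| < δ * e k := fun k =>
      not_le.mp fun hk => hgood.2 ⟨Set.mem_univ _, ⟨k, hk⟩⟩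
    obtain ⟨k, hk⟩ := hG (isHermitian_normGram G₁) (isHermitian_normGram G₂)
    simp only [Prod.map_fst, Prod.map_snd] at hk
    rw [half_smul_add_conjTranspose (isHermitian_normGram G₁),
      half_smul_add_conjTranspose (isHermitian_normGram G₂),
      tailSum_eigsDesc_normGram G₁ k (k₀ := ⟨0, hn⟩) rfl,
      tailSum_eigsDesc_normGram G₂ k (k₀ := ⟨0, hn⟩) rfl] at hk
    have := one_sub_le_sq_ratio hδ hδ4 (hg1 k) (hg2 k) (hg1 ⟨0, hn⟩) (hg2 ⟨0, hn⟩)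
    linarith
  refine (measure_mono hsub).trans ((measure_union_le _ _).trans ?_)
  rw [Measure.prod_prod, Measure.prod_prod, measure_univ, mul_one, one_mul]
  refine (add_le_add hbad_le hbad_le).trans_eq ?_
  rw [← ENNReal.ofReal_add hB0 hB0]
  congr 1
  ring

lemma tendsto_geometric_tail {a : ℝ} (ha : 0 < a) :
    Tendsto (fun L : ℝ => ENNReal.ofReal
      (4 * (Real.exp (-(a * L / 16)) / (1 - Real.exp (-(a * L / 16)))))) atTop (𝓝 0) := by
  have h1 : Tendsto (fun L : ℝ => Real.exp (-(a * L / 16))) atTop (𝓝 0) := by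
    refine Real.tendsto_exp_neg_atTop_nhds_zero.comp ?_
    exact (tendsto_id.const_mul_atTop ha).atTop_div_const (by norm_num)
  have h2 := (h1.div (tendsto_const_nhds.sub h1) (by norm_num : (1 : ℝ) - 0 ≠ 0)).const_mul 4
  have h3 := ENNReal.tendsto_ofReal h2
  simpa using h3

lemma eventually_measureReal_gramResolvent_le {c : ℝ} (hc : 1 < c) {m : ℕ → ℕ}
    (hm : Tendsto (fun n => (m n : ℝ) / n) atTop (𝓝 c)) {t : ℝ} (ht : 0 < t) :
    ∀ᶠ n in atTop, (gaussMatrix n (m n)).real {G | t ≤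
      ∑ k, normSqVec (gramResolvent G *ᵥ Pi.single k 1)} ≤ 1 / 2 := by
  have hc0 : 0 < c := by linarith
  set κ := (c - 1) ^ 2 / c / 2 with hκ
  have hκ0 : 0 < κ := by
    have : 0 < c - 1 := by linarith
    positivity
  have h1 : Tendsto (fun n => ((m n : ℝ) / n - 1) ^ 2 / ((m n : ℝ) / n)) atTop
      (𝓝 ((c - 1) ^ 2 / c)) := ((hm.sub_const 1).pow 2).div hm hc0.ne'
  have h2 := h1.eventually_const_lt (u := κ) (half_lt_self (by positivity))
  have h3 := hm.eventually_const_lt hc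
  have hcast := tendsto_natCast_atTop_atTop (R := ℝ)
  have h4 := (tendsto_const_nhds (x := κ⁻¹ ^ 2 * (64 * (2 + 94 * κ⁻¹) + 2048))).div_atTop hcast
  have h5 := (h4.div_const t).eventually_le_const
    (by norm_num : (0 : ℝ) / t < 1 / 2)
  filter_upwards [h2, h3, h5, eventually_gt_atTop 0, hcast.eventually_ge_atTop (24 / κ)]
    with n hn2 hn3 hn5 hn hn24
  have hn' : (0 : ℝ) < n := by exact_mod_cast hn
  have hmn : (n : ℝ) < m n := by rwa [lt_div_iff₀ hn', one_mul] at hn3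
  have hm0 : (0 : ℝ) < m n := hn'.trans hmn
  have hV : κ * n ≤ ((m n : ℝ) - n) ^ 2 / m n := by
    have h6 : ((m n : ℝ) - n) ^ 2 / m n =
        ((m n : ℝ) / n - 1) ^ 2 / ((m n : ℝ) / n) * n := by
      field_simp
    rw [h6]
    gcongr
  refine (measureReal_gramResolvent_le (u := κ⁻¹) ht hn (by exact_mod_cast hmn.le) ?_ ?_).trans hn5
  · refine le_trans ?_ hV
    rwa [div_le_iff₀ hκ0, mul_comm] at hn24
  · rw [inv_mul_eq_div, le_div_iff₀ hκ0, mul_comm]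
    exact hV

end Conversion

/-- Theorem 3 of the paper: if `m(n)/n → c` for a constant `c ∈ (1, ∞)`, then the maximal
LOCC-conversion success probability `Π` between two independent trace-normalised complex
Wishart--Laguerre samples satisfies `P[Π < 1 − ε] → 0`. -/
theorem approximate_conversion (ε : ℝ) (hε : 0 < ε) (c : ℝ) (hc : 1 < c)
    (m : ℕ → ℕ) (hm0 : ∀ n, 0 < m n)
    (hm : Tendsto (fun n => (m n : ℝ) / n) atTop (𝓝 c)) :
    Tendsto
      (fun n => ((wishartNorm n (m n)).prod (wishartNorm n (m n)))
        {p | PiRatio p.1 p.2 < 1 - ε})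
      atTop (𝓝 0) := by
  obtain ⟨δ, hδ, hδ4, hδε⟩ : ∃ δ : ℝ, 0 < δ ∧ 4 * δ ≤ 1 ∧ 8 * δ ≤ ε :=
    ⟨min (1 / 4) (ε / 8), by positivity, by linarith [min_le_left (1 / 4) (ε / 8)],
      by linarith [min_le_right (1 / 4) (ε / 8)]⟩
  rw [ENNReal.tendsto_nhds_zero]
  intro η hη
  obtain ⟨L, hLη, hL⟩ := (((tendsto_geometric_tail (pow_pos hδ 2)).eventually_le_const hη).and
    (eventually_gt_atTop 0)).exists
  have ht : 0 < ((1 + L) ^ 2)⁻¹ := by positivity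
  filter_upwards [eventually_measureReal_gramResolvent_le hc hm ht, eventually_gt_atTop 0]
    with n hn hn0
  exact (wishartNorm_prod_piRatio_lt_le hn0 hδ hδ4 hδε hL hn).trans hLη
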